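/- arXiv:2603.00914 — 3 statements merged into one kernel-verified Lean document; each statement's English description precedes it below -/
import Mathlib

section
/- Let k ≥ 4 and suppose 0 < r ≤ L_i for every i ∈ {1,…,k}. Then the restricted second configuration space (Star_k)^2_{r,L} is path-connected, and its fundamental group (at any basepoint) is isomorphic to the free group on k² − 3k + 1 generators. -/
/-- A point of the metric star graph before identification: a pair `(i, t)` with
`1 ≤ i ≤ k` and `0 ≤ t ≤ L i`, i.e. a point on the `i`-th edge at distance `t` from
the center. -/
def StarPt (k : ℕ) (L : ℕ → ℝ) : Type :=
  {p : ℕ × ℝ // 1 ≤ p.1 ∧ p.1 ≤ k ∧ 0 ≤ p.2 ∧ p.2 ≤ L p.1}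

/-- The path pseudodistance on the points of the star graph:
`δ((i,s),(j,t)) = |s − t|` if `i = j` and `s + t` otherwise. -/
noncomputable def starDist {k : ℕ} {L : ℕ → ℝ} (p q : StarPt k L) : ℝ :=
  if p.val.1 = q.val.1 then |p.val.2 - q.val.2| else p.val.2 + q.val.2

theorem starDist_self {k : ℕ} {L : ℕ → ℝ} (p : StarPt k L) : starDist p p = 0 := by
  simp [starDist]

theorem starDist_comm {k : ℕ} {L : ℕ → ℝ} (p q : StarPt k L) :
    starDist p q = starDist q p := by
  unfold starDist
  rcases eq_or_ne p.val.1 q.val.1 with h | h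
  · rw [if_pos h, if_pos h.symm, abs_sub_comm]
  · rw [if_neg h, if_neg h.symm, add_comm]

theorem starDist_triangle {k : ℕ} {L : ℕ → ℝ} (p q s : StarPt k L) :
    starDist p s ≤ starDist p q + starDist q s := by
  obtain ⟨hp1, hp2, hp3, hp4⟩ := p.prop
  obtain ⟨hq1, hq2, hq3, hq4⟩ := q.prop
  obtain ⟨hs1, hs2, hs3, hs4⟩ := s.prop
  unfold starDist
  by_cases h1 : p.val.1 = q.val.1 <;> by_cases h2 : q.val.1 = s.val.1
  · rw [if_pos (h1.trans h2), if_pos h1, if_pos h2]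
    exact abs_sub_le _ _ _
  · rw [if_neg (fun h => h2 (h1.symm.trans h)), if_pos h1, if_neg h2]
    have := le_abs_self (p.val.2 - q.val.2)
    linarith
  · rw [if_neg (fun h => h1 (h.trans h2.symm)), if_neg h1, if_pos h2]
    have := neg_le_abs (q.val.2 - s.val.2)
    linarith
  · by_cases h3 : p.val.1 = s.val.1
    · rw [if_pos h3, if_neg h1, if_neg h2]
      rw [abs_sub_le_iff]
      constructor <;> linarith
    · rw [if_neg h3, if_neg h1, if_neg h2]
      linarith

/-- The path pseudometric space structure on the points of the star graph. -/
noncomputable instance starPseudoMetricSpace (k : ℕ) (L : ℕ → ℝ) :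
    PseudoMetricSpace (StarPt k L) where
  dist := starDist
  dist_self := starDist_self
  dist_comm := starDist_comm
  dist_triangle := starDist_triangle

/-- The metric star graph `Star_k(L)`: the quotient of the pseudometric space of points
by the identification of points at pseudodistance zero (a metric space). -/
abbrev StarGraph (k : ℕ) (L : ℕ → ℝ) : Type := SeparationQuotient (StarPt k L)

/-- The restricted second configuration space `(Star_k)²_{r,L}`, as a topological subspace
of the product `Star_k(L) × Star_k(L)`. -/
abbrev ConfigSpace (k : ℕ) (L : ℕ → ℝ) (r : ℝ) : Type :=
  {pq : StarGraph k L × StarGraph k L // r ≤ dist pq.1 pq.2}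

section Helpers
open Set Filter Topology


/-- A two-chart principal covering built from a locally constant transition function. -/
lemma exists_two_chart_cover {X : Type} [TopologicalSpace X] {F : Type} [Group F]
    (A B : Set X) (hA : IsOpen A) (hB : IsOpen B) (hAB : ∀ x, x ∈ A ∨ x ∈ B)
    (l : X → F) (hl : ∀ x ∈ A ∩ B, ∀ᶠ y in 𝓝 x, l y = l x) :
    ∃ (E : Type) (_ : TopologicalSpace E) (p : E → X) (_ : IsCoveringMap p)
      (sA sB : X → F → E),
      (∀ w, ContinuousOn (fun x => sA x w) A) ∧ (∀ w, ContinuousOn (fun x => sB x w) B) ∧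
      (∀ x w, p (sA x w) = x) ∧ (∀ x w, p (sB x w) = x) ∧
      (∀ x ∈ A ∩ B, ∀ w, sA x w = sB x (l x * w)) ∧
      (∀ x ∈ A, Function.Injective (sA x)) := by
  classical
  let _ : TopologicalSpace F := ⊥
  have : DiscreteTopology F := ⟨rfl⟩
  let bs : Bool → Set X := fun b => if b then A else B
  let cc : Bool → Bool → X → F → F := fun b b' x w =>
    match b, b' with
    | true, true => w
    | false, false => w
    | true, false => l x * w
    | false, true => (l x)⁻¹ * w
  have key : ∀ f : X → F, (∀ x ∈ A ∩ B, ∀ᶠ y in 𝓝 x, f y = f x) → ∀ S ⊆ A ∩ B,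
      ContinuousOn (fun p : X × F => f p.1 * p.2) (S ×ˢ univ) := by
    intro f hf S hS
    rintro ⟨x, w⟩ ⟨hx, -⟩
    apply ContinuousAt.continuousWithinAt
    have h1 : ContinuousAt (fun p : X × F => f x * p.2) (x, w) :=
      (continuous_of_discreteTopology (f := fun w : F => f x * w)).continuousAt.comp
        continuousAt_snd
    refine h1.congr ?_
    have := (continuousAt_fst (p := (x, w))).eventually (hf x (hS hx))
    filter_upwards [this] with q hq
    rw [hq]
  let Z : FiberBundleCore Bool X F :=
    { baseSet := bs
      isOpen_baseSet := by intro b; cases b <;> simpa [bs]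
      indexAt := fun x => decide (x ∈ A)
      mem_baseSet_at := by
        intro x
        by_cases h : x ∈ A
        · simp [bs, h]
        · simpa [bs, h] using (hAB x).resolve_left h
      coordChange := cc
      coordChange_self := by intro b x _ w; cases b <;> rfl
      continuousOn_coordChange := by
        intro b b'
        cases b <;> cases b'
        · exact continuousOn_snd
        · refine key (fun x => (l x)⁻¹) ?_ _ ?_
          · intro x hx
            filter_upwards [hl x hx] with y hy
            rw [hy]
          · simp [bs, inter_comm]
        · exact key l hl _ (by simp [bs])
        · exact continuousOn_snd
      coordChange_comp := by
        intro a b c x _ w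
        cases a <;> cases b <;> cases c <;> simp [cc] }
  refine ⟨Z.TotalSpace, inferInstance, Z.proj, FiberBundle.isCoveringMap (F := F) (E := Z.Fiber),
    fun x w => (Z.localTriv true).toOpenPartialHomeomorph.symm (x, w),
    fun x w => (Z.localTriv false).toOpenPartialHomeomorph.symm (x, w),
    ?_, ?_, ?_, ?_, ?_, ?_⟩
  · intro w
    refine (Z.localTriv true).toOpenPartialHomeomorph.continuousOn_symm.comp
      (by fun_prop) ?_
    intro x hx
    rw [FiberBundleCore.mem_localTriv_target]
    simpa [Z, bs] using! hx
  · intro w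
    refine (Z.localTriv false).toOpenPartialHomeomorph.continuousOn_symm.comp
      (by fun_prop) ?_
    intro x hx
    rw [FiberBundleCore.mem_localTriv_target]
    simpa [Z, bs] using! hx
  · intro x w; rfl
  · intro x w; rfl
  · intro x hx w
    simp only [FiberBundleCore.localTriv_symm_apply]
    have : Z.indexAt x = true := by simp [Z, hx.1]
    rw [this]
    simp [Z, cc]
  · intro x hx w w' h
    simp only [FiberBundleCore.localTriv_symm_apply] at h
    have : Z.indexAt x = true := by simp [Z, hx]
    rw [this] at h
    injection h

/-- Propagation of a predicate on path classes along paths subordinate to an open cover. -/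
lemma path_induction {X : Type} [TopologicalSpace X] {ι : Type} (W : ι → Set X)
    (hW : ∀ i, IsOpen (W i)) (hcov : ∀ x, ∃ i, x ∈ W i) {x₀ : X}
    (P : ∀ x, Path.Homotopic.Quotient x₀ x → Prop)
    (hP : ∀ i x y (g : Path.Homotopic.Quotient x₀ x) (q : Path x y), (∀ t, q t ∈ W i) →
      P x g → P y (g.trans (.mk q)))
    {x y : X} (g : Path.Homotopic.Quotient x₀ x) (q : Path x y) (h : P x g) :
    P y (g.trans (.mk q)) := by
  obtain ⟨f, rfl, rfl⟩ := q
  let q : Path (f 0) (f 1) := ⟨f, rfl, rfl⟩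
  obtain ⟨t, t0, tmono, ⟨n, hn⟩, tsub⟩ := exists_monotone_Icc_subset_open_cover_unitInterval
    (fun i => (hW i).preimage q.continuous)
    (fun s _ => by obtain ⟨i, hi⟩ := hcov (q s); exact mem_iUnion.2 ⟨i, hi⟩)
  have main : ∀ m, P (q (t m)) (g.trans (.mk (q.subpath 0 (t m)))) := by
    intro m
    induction m with
    | zero =>
      rw [t0, Path.subpath_self]
      have e : g.trans (.mk (Path.refl (f 0))) = g := Path.Homotopic.Quotient.trans_refl g
      change P (f 0) (g.trans (.mk (Path.refl (f 0))))
      rwa [e]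
    | succ m ih =>
      obtain ⟨i, hi⟩ := tsub m
      have := hP i _ _ _ (q.subpath (t m) (t (m+1))) (by
        intro s
        have h1 : q.subpath (t m) (t (m+1)) s ∈ range (q.subpath (t m) (t (m+1))) := ⟨s, rfl⟩
        rw [Path.range_subpath_of_le _ _ _ (tmono (Nat.le_succ m))] at h1
        obtain ⟨u, hu, hu'⟩ := h1
        rw [← hu']
        exact hi hu) ih
      rw [Path.Homotopic.Quotient.trans_assoc, ← Path.Homotopic.Quotient.mk_trans] at this
      rwa [Path.Homotopic.Quotient.eq.2 ⟨Path.Homotopy.subpathTransSubpath q 0 (t m) (t (m+1))⟩]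
        at this
  have := main n
  rw [hn n le_rfl] at this
  rw [Path.subpath_zero_one] at this
  exact this


/-- The path class is represented by a path inside `S`. -/
def InCls {X : Type} [TopologicalSpace X] (S : Set X) {x y : X}
    (g : Path.Homotopic.Quotient x y) : Prop :=
  ∃ p : Path x y, (∀ t, p t ∈ S) ∧ Path.Homotopic.Quotient.mk p = g

lemma InCls.trans {X : Type} [TopologicalSpace X] {S : Set X} {x y z : X}
    {g : Path.Homotopic.Quotient x y} {h : Path.Homotopic.Quotient y z}
    (hg : InCls S g) (hh : InCls S h) : InCls S (g.trans h) := by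
  obtain ⟨p, hp, rfl⟩ := hg
  obtain ⟨q, hq, rfl⟩ := hh
  refine ⟨p.trans q, ?_, rfl⟩
  intro t
  rw [Path.trans_apply]
  split_ifs
  · exact hp _
  · exact hq _

lemma InCls.symm {X : Type} [TopologicalSpace X] {S : Set X} {x y : X}
    {g : Path.Homotopic.Quotient x y} (hg : InCls S g) : InCls S g.symm := by
  obtain ⟨p, hp, rfl⟩ := hg
  exact ⟨p.symm, fun t => hp _, rfl⟩

lemma InCls.mono {X : Type} [TopologicalSpace X] {S T : Set X} (h : S ⊆ T) {x y : X}
    {g : Path.Homotopic.Quotient x y} (hg : InCls S g) : InCls T g := by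
  obtain ⟨p, hp, rfl⟩ := hg
  exact ⟨p, fun t => h (hp t), rfl⟩

lemma InCls.refl {X : Type} [TopologicalSpace X] {S : Set X} {x : X} (h : x ∈ S) :
    InCls S (Path.Homotopic.Quotient.refl x) := ⟨Path.refl x, fun _ => h, rfl⟩

lemma exists_inCls {X : Type} [TopologicalSpace X] {S : Set X} (hS : IsPathConnected S)
    {x y : X} (hx : x ∈ S) (hy : y ∈ S) : ∃ g : Path.Homotopic.Quotient x y, InCls S g := by
  obtain ⟨p, hp⟩ := hS.joinedIn x hx y hy
  exact ⟨.mk p, p, hp, rfl⟩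

lemma inCls_unique {X : Type} [TopologicalSpace X] {S : Set X} (hS : SimplyConnectedSpace S)
    {x y : X} {g h : Path.Homotopic.Quotient x y} (hg : InCls S g) (hh : InCls S h) : g = h := by
  obtain ⟨p, hp, rfl⟩ := hg
  obtain ⟨q, hq, rfl⟩ := hh
  have hx : x ∈ S := by simpa using hp 0
  have hy : y ∈ S := by simpa using hp 1
  let P : Path (⟨x, hx⟩ : S) ⟨y, hy⟩ :=
    { toFun := fun t => ⟨p t, hp t⟩, continuous_toFun := by fun_prop
      source' := by simp, target' := by simp }
  let Q : Path (⟨x, hx⟩ : S) ⟨y, hy⟩ :=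
    { toFun := fun t => ⟨q t, hq t⟩, continuous_toFun := by fun_prop
      source' := by simp, target' := by simp }
  have h1 := (SimplyConnectedSpace.paths_homotopic P Q).map ⟨Subtype.val, continuous_subtype_val⟩
  exact Path.Homotopic.Quotient.eq.2 h1

lemma isPathConnected_of_sc {X : Type} [TopologicalSpace X] {S : Set X}
    (hS : SimplyConnectedSpace S) : IsPathConnected S :=
  isPathConnected_iff_pathConnectedSpace.2 inferInstance

/-- Relational form of monodromy. -/
def Lft {X E : Type} [TopologicalSpace X] [TopologicalSpace E] {p : E → X} (cov : IsCoveringMap p)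
    {x y : X} (g : Path.Homotopic.Quotient x y) (e e' : E) : Prop :=
  ∃ h : p e = x, (cov.monodromy g ⟨e, h⟩ : E) = e'

section Lft
variable {X E : Type} [TopologicalSpace X] [TopologicalSpace E] {p : E → X}
  {cov : IsCoveringMap p} {x y z : X}

lemma Lft.trans {g : Path.Homotopic.Quotient x y} {h : Path.Homotopic.Quotient y z}
    {e e' e'' : E} (hg : Lft cov g e e') (hh : Lft cov h e' e'') :
    Lft cov (g.trans h) e e'' := by
  obtain ⟨h1, rfl⟩ := hg
  obtain ⟨h2, rfl⟩ := hh
  exact ⟨h1, by rw [cov.monodromy_trans_apply]⟩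

lemma Lft.symm {g : Path.Homotopic.Quotient x y} {e e' : E} (hg : Lft cov g e e') :
    Lft cov g.symm e' e := by
  obtain ⟨h1, rfl⟩ := hg
  refine ⟨(cov.monodromy g ⟨e, h1⟩).2, ?_⟩
  have := cov.monodromy_trans_apply g g.symm ⟨e, h1⟩
  rw [Path.Homotopic.Quotient.trans_symm, cov.monodromy_refl] at this
  exact (congrArg Subtype.val this).symm

lemma Lft.unique {g : Path.Homotopic.Quotient x y} {e e' e'' : E} (hg : Lft cov g e e')
    (hg' : Lft cov g e e'') : e' = e'' := by
  obtain ⟨h1, rfl⟩ := hg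
  obtain ⟨h2, rfl⟩ := hg'
  rfl

lemma Lft.refl {e : E} (h : p e = x) : Lft cov (.refl x) e e :=
  ⟨h, by rw [cov.monodromy_refl]; rfl⟩

lemma Lft.of_inCls {S : Set X} {s : X → E} (hs : ContinuousOn s S) (hps : ∀ x, p (s x) = x)
    {g : Path.Homotopic.Quotient x y} (hg : InCls S g) : Lft cov g (s x) (s y) := by
  obtain ⟨q, hq, rfl⟩ := hg
  refine ⟨hps x, ?_⟩
  let Γ : Path (s x) (s y) :=
    { toFun := fun t => s (q t)
      continuous_toFun := hs.comp_continuous q.continuous hq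
      source' := by simp, target' := by simp }
  have := cov.monodromy_eq_of_map_eq (γ := Path.Homotopic.Quotient.mk q)
    (ex := ⟨s x, hps x⟩) (ey := ⟨s y, hps y⟩) (.mk Γ) (by
      refine congrArg Path.Homotopic.Quotient.mk ?_
      ext t
      exact hps (q t))
  rw [this]

end Lft

/-- Edges of the chosen spanning tree. -/
def TreeE {I : Type} (o0 o1 o2 : I) (i j : I) : Prop :=
  i = o0 ∨ j = o1 ∨ (i = o1 ∧ j = o2) ∨ (i = o2 ∧ j = o0)

/-- Edges outside the chosen spanning tree. -/
abbrev GenE {I : Type} (o0 o1 o2 : I) : Type :=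
  {e : I × I // e.1 ≠ e.2 ∧ ¬ TreeE o0 o1 o2 e.1 e.2}

open Classical in
/-- Label of an edge. -/
noncomputable def lab {I : Type} (o0 o1 o2 : I) (i j : I) : FreeGroup (GenE o0 o1 o2) :=
  if h : i ≠ j ∧ ¬ TreeE o0 o1 o2 i j then FreeGroup.of ⟨(i, j), h⟩ else 1

/-- A cover by two families of simply connected open sets with bipartite nerve. -/
structure BipCover (X : Type) [TopologicalSpace X] (I : Type) (U V : I → Set X) : Prop where
  openU : ∀ i, IsOpen (U i)
  openV : ∀ i, IsOpen (V i)
  disjU : ∀ i j x, x ∈ U i → x ∈ U j → i = j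
  disjV : ∀ i j x, x ∈ V i → x ∈ V j → i = j
  emp : ∀ i x, x ∈ U i → x ∈ V i → False
  cover : ∀ x, (∃ i, x ∈ U i) ∨ (∃ i, x ∈ V i)
  pcUV : ∀ i j, i ≠ j → IsPathConnected (U i ∩ V j)
  scU : ∀ i, SimplyConnectedSpace (U i)
  scV : ∀ i, SimplyConnectedSpace (V i)

open Path.Homotopic.Quotient in
theorem bip_pi1 {X : Type} [TopologicalSpace X] {I : Type} {U V : I → Set X}
    (H : BipCover X I U V) (o0 o1 o2 : I) (h01 : o0 ≠ o1) (h02 : o0 ≠ o2) (h12 : o1 ≠ o2) :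
    PathConnectedSpace X ∧ ∃ x : X, Nonempty
      (FundamentalGroup X x ≃* FreeGroup (GenE o0 o1 o2)) := by
  classical
  have pcU := fun i => isPathConnected_of_sc (H.scU i)
  have pcV := fun i => isPathConnected_of_sc (H.scV i)
  choose a ha using fun i => (pcU i).nonempty
  choose b hb using fun i => (pcV i).nonempty
  have hε : ∀ i j, i ≠ j → ∃ e : Path.Homotopic.Quotient (a i) (b j),
      ∃ m ∈ U i ∩ V j, ∃ (p : Path.Homotopic.Quotient (a i) m)
        (q : Path.Homotopic.Quotient m (b j)), InCls (U i) p ∧ InCls (V j) q ∧ e = p.trans q := by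
    intro i j hij
    obtain ⟨m, hm⟩ := (H.pcUV i j hij).nonempty
    obtain ⟨p, hp⟩ := exists_inCls (pcU i) (ha i) hm.1
    obtain ⟨q, hq⟩ := exists_inCls (pcV j) hm.2 (hb j)
    exact ⟨_, m, hm, p, q, hp, hq, rfl⟩
  choose ε hε using hε
  -- change of chart
  have hchg : ∀ i j (hij : i ≠ j) x, x ∈ U i → x ∈ V j →
      ∀ (p : Path.Homotopic.Quotient (a i) x) (q : Path.Homotopic.Quotient (b j) x),
      InCls (U i) p → InCls (V j) q → p = (ε i j hij).trans q := by
    intro i j hij x hxU hxV p q hp hq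
    obtain ⟨m, hm, p', q', hp', hq', he⟩ := hε i j hij
    obtain ⟨z, hz⟩ := exists_inCls (H.pcUV i j hij) hm ⟨hxU, hxV⟩
    have e1 : p = p'.trans z :=
      inCls_unique (H.scU i) hp (hp'.trans (hz.mono inter_subset_left))
    have e2 : z = q'.trans q :=
      inCls_unique (H.scV j) (hz.mono inter_subset_right) (hq'.trans hq)
    rw [he, e1, e2, trans_assoc]
  -- tree paths
  let c : ∀ i, Path.Homotopic.Quotient (a o0) (a i) := fun i =>
    if h : i ≠ o1 then (ε o0 o1 h01).trans (ε i o1 h).symm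
    else (ε o0 o2 h02).trans (ε i o2 (by rw [not_not.1 h]; exact h12)).symm
  let d : ∀ j, Path.Homotopic.Quotient (a o0) (b j) := fun j =>
    if h : o0 ≠ j then ε o0 j h
    else ((ε o0 o1 h01).trans (ε o2 o1 h12.symm).symm).trans
      (ε o2 j (by rw [← not_not.1 h]; exact h02.symm))
  have hc0 : c o0 = .refl _ := by
    simp only [c]
    rw [dif_pos h01, Path.Homotopic.Quotient.trans_symm]
  have htree : ∀ i j (h : i ≠ j), TreeE o0 o1 o2 i j → (c i).trans (ε i j h) = d j := by
    rintro i j h (rfl | rfl | ⟨rfl, rfl⟩ | ⟨rfl, rfl⟩)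
    · rw [hc0, refl_trans]
      simp only [d]
      rw [dif_pos h]
    · simp only [c, d]
      rw [dif_pos h, dif_pos h01, trans_assoc, symm_trans, trans_refl]
    · simp only [c, d]
      rw [dif_neg (by simp), dif_pos h02, trans_assoc, symm_trans, trans_refl]
    · simp only [c, d]
      rw [dif_pos h12.symm, dif_neg (by simp)]
  let φ : FreeGroup (GenE o0 o1 o2) →* FundamentalGroup X (a o0) :=
    FreeGroup.lift (fun g => FundamentalGroup.fromPath
      (((c g.1.1).trans (ε g.1.1 g.1.2 g.2.1)).trans (d g.1.2).symm))
  let φ' : FreeGroup (GenE o0 o1 o2) → Path.Homotopic.Quotient (a o0) (a o0) := fun w => φ w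
  have φ'_mul : ∀ v w, φ' (v * w) = (φ' w).trans (φ' v) := by
    intro v w
    simp only [φ', map_mul]
    rfl
  have φ'_one : φ' 1 = .refl _ := by
    simp only [φ', map_one]
    rfl
  have φ'_of : ∀ g : GenE o0 o1 o2, φ' (FreeGroup.of g) =
      ((c g.1.1).trans (ε g.1.1 g.1.2 g.2.1)).trans (d g.1.2).symm := by
    intro g
    simp only [φ', φ, FreeGroup.lift_apply_of]
  have φ'_inv : ∀ v, φ' (v⁻¹) = (φ' v).symm := by
    intro v
    simp only [φ', map_inv]
    rfl
  have key : ∀ i j (h : i ≠ j), (c i).trans (ε i j h) = (φ' (lab o0 o1 o2 i j)).trans (d j) := by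
    intro i j h
    by_cases ht : TreeE o0 o1 o2 i j
    · rw [lab, dif_neg (by tauto), φ'_one, refl_trans, htree i j h ht]
    · rw [lab, dif_pos ⟨h, ht⟩, φ'_of, trans_assoc, symm_trans, trans_refl]
  -- good classes
  let GA : ∀ i x, Path.Homotopic.Quotient (a o0) x → Prop := fun i x g =>
    ∃ w, ∃ p : Path.Homotopic.Quotient (a i) x, InCls (U i) p ∧
      g = (φ' w).trans ((c i).trans p)
  let GB : ∀ j x, Path.Homotopic.Quotient (a o0) x → Prop := fun j x g =>
    ∃ w, ∃ p : Path.Homotopic.Quotient (b j) x, InCls (V j) p ∧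
      g = (φ' w).trans ((d j).trans p)
  have AB : ∀ i j x, x ∈ U i → x ∈ V j → ∀ g, GA i x g → GB j x g := by
    rintro i j x hi hj g ⟨w, p, hp, rfl⟩
    have hij : i ≠ j := by rintro rfl; exact H.emp _ _ hi hj
    obtain ⟨q, hq⟩ := exists_inCls (pcV j) (hb j) hj
    refine ⟨lab o0 o1 o2 i j * w, q, hq, ?_⟩
    rw [hchg i j hij x hi hj p q hp hq, φ'_mul, ← trans_assoc (c i), key, trans_assoc, trans_assoc]
  have BA : ∀ i j x, x ∈ U i → x ∈ V j → ∀ g, GB j x g → GA i x g := by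
    rintro i j x hi hj g ⟨w, q, hq, rfl⟩
    have hij : i ≠ j := by rintro rfl; exact H.emp _ _ hi hj
    obtain ⟨p, hp⟩ := exists_inCls (pcU i) (ha i) hi
    refine ⟨(lab o0 o1 o2 i j)⁻¹ * w, p, hp, ?_⟩
    rw [hchg i j hij x hi hj p q hp hq, φ'_mul, ← trans_assoc (c i), key, φ'_inv]
    simp only [trans_assoc]
    rw [← trans_assoc (φ' (lab o0 o1 o2 i j)).symm, symm_trans, refl_trans]
  let Good : ∀ x, Path.Homotopic.Quotient (a o0) x → Prop := fun x g =>
    (∃ i, x ∈ U i ∧ GA i x g) ∨ (∃ j, x ∈ V j ∧ GB j x g)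
  have GoodA : ∀ i x, x ∈ U i → ∀ g, Good x g → GA i x g := by
    rintro i x hx g (⟨i', hi', h⟩ | ⟨j, hj, h⟩)
    · obtain rfl := H.disjU _ _ _ hx hi'
      exact h
    · exact BA i j x hx hj g h
  have GoodB : ∀ i x, x ∈ V i → ∀ g, Good x g → GB i x g := by
    rintro i x hx g (⟨j, hj, h⟩ | ⟨i', hi', h⟩)
    · exact AB j i x hj hx g h
    · obtain rfl := H.disjV _ _ _ hx hi'
      exact h
  have hGood : ∀ x y (g : Path.Homotopic.Quotient (a o0) x) (q : Path x y), Good x g →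
      Good y (g.trans (.mk q)) := by
    intro x y g q hg
    refine path_induction (Sum.elim U V) (by rintro (i | i); exacts [H.openU i, H.openV i])
      (fun x => ?_) Good ?_ g q hg
    · rcases H.cover x with ⟨i, hi⟩ | ⟨i, hi⟩
      exacts [⟨.inl i, hi⟩, ⟨.inr i, hi⟩]
    · rintro (i | i) x y g q hq hg
      · have hx : x ∈ U i := by simpa using hq 0
        have hy : y ∈ U i := by simpa using hq 1
        obtain ⟨w, p, hp, rfl⟩ := GoodA i x hx g hg
        refine .inl ⟨i, hy, w, p.trans (.mk q), hp.trans ⟨q, hq, rfl⟩, ?_⟩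
        simp only [trans_assoc]
      · have hx : x ∈ V i := by simpa using hq 0
        have hy : y ∈ V i := by simpa using hq 1
        obtain ⟨w, p, hp, rfl⟩ := GoodB i x hx g hg
        refine .inr ⟨i, hy, w, p.trans (.mk q), hp.trans ⟨q, hq, rfl⟩, ?_⟩
        simp only [trans_assoc]
  have hbase : Good (a o0) (.refl _) := by
    refine .inl ⟨o0, ha o0, 1, .refl _, InCls.refl (ha o0), ?_⟩
    rw [hc0, φ'_one, refl_trans, refl_trans]
  have surj : Function.Surjective φ := by
    intro g
    obtain ⟨q, hq⟩ := mk_surjective (g : Path.Homotopic.Quotient (a o0) (a o0))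
    have h1 := hGood _ _ _ q hbase
    rw [refl_trans] at h1
    obtain ⟨w, p, hp, h2⟩ := GoodA o0 _ (ha o0) _ h1
    have h3 : p = .refl _ := inCls_unique (H.scU o0) hp (InCls.refl (ha o0))
    rw [h3, hc0, trans_refl, trans_refl, hq] at h2
    exact ⟨w, h2.symm⟩
  -- path connectedness
  have hjoin : ∀ x, Joined (a o0) x := by
    intro x
    have fin : ∀ y, Path.Homotopic.Quotient (a o0) y → Joined (a o0) y := by
      intro y g
      obtain ⟨q, -⟩ := mk_surjective g
      exact ⟨q⟩
    rcases H.cover x with ⟨i, hi⟩ | ⟨i, hi⟩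
    · exact (fin _ (c i)).trans ((pcU i).joinedIn _ (ha i) _ hi).joined
    · exact (fin _ (d i)).trans ((pcV i).joinedIn _ (hb i) _ hi).joined
  -- the covering
  let l : X → FreeGroup (GenE o0 o1 o2) := fun x =>
    if h : ∃ e : I × I, x ∈ U e.1 ∧ x ∈ V e.2 then lab o0 o1 o2 h.choose.1 h.choose.2 else 1
  have hl : ∀ i j x, x ∈ U i → x ∈ V j → l x = lab o0 o1 o2 i j := by
    intro i j x hi hj
    have h : ∃ e : I × I, x ∈ U e.1 ∧ x ∈ V e.2 := ⟨(i, j), hi, hj⟩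
    simp only [l]
    rw [dif_pos h, H.disjU _ _ _ h.choose_spec.1 hi, H.disjV _ _ _ h.choose_spec.2 hj]
  obtain ⟨E, _, p, cov, sA, sB, hsA, hsB, psA, psB, hsAB, hinj⟩ :=
    exists_two_chart_cover (⋃ i, U i) (⋃ i, V i) (isOpen_iUnion H.openU)
      (isOpen_iUnion H.openV) (by simpa using H.cover) l (by
        rintro x ⟨hx, hx'⟩
        obtain ⟨i, hi⟩ := mem_iUnion.1 hx
        obtain ⟨j, hj⟩ := mem_iUnion.1 hx'
        filter_upwards [(H.openU i).mem_nhds hi, (H.openV j).mem_nhds hj] with y hy hy'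
        rw [hl i j x hi hj, hl i j y hy hy'])
  have Lε : ∀ i j h w, Lft cov (ε i j h) (sA (a i) w) (sB (b j) (lab o0 o1 o2 i j * w)) := by
    intro i j h w
    obtain ⟨m, hm, p', q', hp', hq', he⟩ := hε i j h
    rw [he]
    have h1 := Lft.of_inCls (cov := cov) (hsA w) (fun x => psA x w)
      (hp'.mono (subset_iUnion U i))
    have h2 := Lft.of_inCls (cov := cov) (hsB (lab o0 o1 o2 i j * w)) (fun x => psB x _)
      (hq'.mono (subset_iUnion V j))
    rw [hsAB m ⟨mem_iUnion.2 ⟨i, hm.1⟩, mem_iUnion.2 ⟨j, hm.2⟩⟩, hl i j m hm.1 hm.2] at h1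
    exact h1.trans h2
  have Lεt : ∀ i j h w, TreeE o0 o1 o2 i j →
      Lft cov (ε i j h) (sA (a i) w) (sB (b j) w) := by
    intro i j h w ht
    have := Lε i j h w
    rwa [lab, dif_neg (by tauto), one_mul] at this
  have Lc : ∀ i w, Lft cov (c i) (sA (a o0) w) (sA (a i) w) := by
    intro i w
    simp only [c]
    split_ifs with h
    · exact (Lεt o0 o1 h01 w (.inl rfl)).trans (Lεt i o1 h w (.inr (.inl rfl))).symm
    · have h' := not_not.1 h
      subst h'
      exact (Lεt o0 o2 h02 w (.inl rfl)).trans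
        (Lεt _ o2 h12 w (.inr (.inr (.inl ⟨rfl, rfl⟩)))).symm
  have Ld : ∀ j w, Lft cov (d j) (sA (a o0) w) (sB (b j) w) := by
    intro j w
    simp only [d]
    split_ifs with h
    · exact Lεt o0 j h w (.inl rfl)
    · have h' := not_not.1 h
      subst h'
      exact ((Lεt _ o1 h01 w (.inl rfl)).trans
        (Lεt o2 o1 h12.symm w (.inr (.inl rfl))).symm).trans
        (Lεt o2 _ h02.symm w (.inr (.inr (.inr ⟨rfl, rfl⟩))))
  have Lφ : ∀ v w, Lft cov (φ' v) (sA (a o0) w) (sA (a o0) (v * w)) := by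
    intro v
    induction v using FreeGroup.induction_on with
    | C1 => intro w; rw [φ'_one, one_mul]; exact Lft.refl (psA _ _)
    | of g =>
      intro w
      have h0 : lab o0 o1 o2 g.1.1 g.1.2 = FreeGroup.of g := by
        rw [lab, dif_pos g.2]
      change Lft cov (φ' (FreeGroup.of g)) _ (sA (a o0) (FreeGroup.of g * w))
      rw [φ'_of, ← h0]
      exact ((Lc _ w).trans (Lε _ _ g.2.1 w)).trans (Ld _ _).symm
    | inv_of g ih =>
      intro w
      have := (ih ((FreeGroup.of g)⁻¹ * w)).symm
      rw [φ'_inv]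
      change Lft cov _ _ (sA (a o0) ((FreeGroup.of g)⁻¹ * w))
      change Lft cov _ (sA (a o0) (FreeGroup.of g * ((FreeGroup.of g)⁻¹ * w))) _ at this
      rwa [mul_inv_cancel_left] at this
    | mul u v hu hv =>
      intro w
      rw [φ'_mul, mul_assoc]
      exact (hv w).trans (hu _)
  have inj : Function.Injective φ := by
    rw [injective_iff_map_eq_one]
    intro v hv
    have h1 := Lφ v 1
    have h2 : φ' v = .refl _ := hv
    rw [h2] at h1
    have h3 := h1.unique (Lft.refl (psA _ _))
    have h4 := hinj _ (mem_iUnion.2 ⟨o0, ha o0⟩) h3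
    simpa using h4
  refine ⟨⟨⟨a o0⟩, fun x y => (hjoin x).symm.trans (hjoin y)⟩, a o0,
    ⟨(MulEquiv.ofBijective φ ⟨inj, surj⟩).symm⟩⟩

lemma card_genE (n : ℕ) : Nat.card (GenE (0 : Fin (n+3)) 1 2) = (n+3)^2 - 3*(n+3) + 1 := by
  classical
  have v2 : ((2 : Fin (n+3)) : ℕ) = 2 := Nat.mod_eq_of_lt (a := 2) (b := n + 3) (by omega)
  have h2 : ∀ i : Fin n, i.succ.succ.succ ≠ (2 : Fin (n+3)) := by
    intro i h; have := congrArg Fin.val h; rw [v2] at this; simp at this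
  have h1 : ∀ i : Fin n, i.succ.succ.succ ≠ (1 : Fin (n+3)) := by
    intro i h; have := congrArg Fin.val h; simp at this
  have h0 : ∀ i : Fin n, i.succ.succ.succ ≠ (0 : Fin (n+3)) := by
    intro i h; have := congrArg Fin.val h; simp at this
  have e1 : Fin.succ (0 : Fin (n+2)) = 1 := rfl
  have e2 : Fin.succ (Fin.succ (0 : Fin (n+1))) = 2 := rfl
  have d1 : (0 : Fin (n+3)) ≠ 1 := by intro h; have := congrArg Fin.val h; simp at this
  have d2 : (0 : Fin (n+3)) ≠ 2 := by intro h; have := congrArg Fin.val h; rw [v2] at this; simp at this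
  have d3 : (1 : Fin (n+3)) ≠ 2 := by intro h; have := congrArg Fin.val h; rw [v2] at this; simp at this
  rw [Nat.card_eq_fintype_card, Fintype.card_subtype, Finset.card_filter,
    Fintype.sum_prod_type]
  have hrow : ∀ i : Fin n, ∑ m : Fin n, (if i = m then 0 else 1) = n - 1 := by
    intro i
    rw [Finset.sum_ite, Finset.sum_const_zero, zero_add, Finset.sum_const, smul_eq_mul, mul_one,
      Finset.filter_not, Finset.filter_eq]
    simp [Finset.card_sdiff]
  simp only [Fin.sum_univ_succ, TreeE, e1, e2]
  simp [h0, h1, h2, d1, d2, d3, d1.symm, d2.symm, d3.symm, (h0 _).symm, (h1 _).symm,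
    (h2 _).symm, hrow]
  have e3 : (n + 3) ^ 2 - 3 * (n + 3) = n ^ 2 + 3 * n := by
    rw [show (n + 3) ^ 2 = n ^ 2 + 3 * n + 3 * (n + 3) by ring, Nat.add_sub_cancel]
  rw [e3]
  cases n with
  | zero => rfl
  | succ m => simp only [Nat.add_sub_cancel]; ring

section Model
variable {k : ℕ} (l : Fin k → ℝ) (r : ℝ)

def MStar : Set (Fin k → ℝ) :=
  {x | (∀ i, 0 ≤ x i ∧ x i ≤ l i) ∧ ∀ i j, i ≠ j → x i = 0 ∨ x j = 0}

def MConf : Set ((Fin k → ℝ) × (Fin k → ℝ)) :=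
  {z | z.1 ∈ MStar l ∧ z.2 ∈ MStar l ∧ r ≤ ∑ i, |z.1 i - z.2 i|}

lemma sum_abs_star {x y : Fin k → ℝ} (i : Fin k) (hx : ∀ m, m ≠ i → x m = 0)
    (hy : ∀ m, 0 ≤ y m) (h : y i ≤ x i) :
    ∑ m, |x m - y m| = x i - 2 * y i + ∑ m, y m := by
  classical
  rw [← Finset.add_sum_erase _ _ (Finset.mem_univ i), ← Finset.add_sum_erase _ y (Finset.mem_univ i),
    abs_of_nonneg (by linarith)]
  have : ∑ m ∈ Finset.univ.erase i, |x m - y m| = ∑ m ∈ Finset.univ.erase i, y m := by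
    apply Finset.sum_congr rfl
    intro m hm
    rw [hx m (Finset.ne_of_mem_erase hm), zero_sub, abs_neg, abs_of_nonneg (hy m)]
  rw [this]; ring

def MA (i : Fin k) : Set ((Fin k → ℝ) × (Fin k → ℝ)) := {z | z ∈ MConf l r ∧ z.2 i < z.1 i}
def MB (i : Fin k) : Set ((Fin k → ℝ) × (Fin k → ℝ)) := {z | z ∈ MConf l r ∧ z.1 i < z.2 i}

lemma mem_MA (i : Fin k) (z : (Fin k → ℝ) × (Fin k → ℝ)) :
    z ∈ MA l r i ↔ (∀ m, m ≠ i → z.1 m = 0) ∧ z.1 i ≤ l i ∧ z.2 ∈ MStar l ∧ z.2 i < z.1 i ∧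
      r ≤ z.1 i - 2 * z.2 i + ∑ m, z.2 m := by
  constructor
  · rintro ⟨⟨h1, h2, h3⟩, h4⟩
    have hp : 0 < z.1 i := lt_of_le_of_lt (h2.1 i).1 h4
    have h0 : ∀ m, m ≠ i → z.1 m = 0 := by
      intro m hm
      rcases h1.2 m i hm with h | h
      · exact h
      · exact absurd h hp.ne'
    refine ⟨h0, (h1.1 i).2, h2, h4, ?_⟩
    rwa [sum_abs_star i h0 (fun m => (h2.1 m).1) h4.le] at h3
  · rintro ⟨h0, h1, h2, h4, h5⟩
    have hp : 0 < z.1 i := lt_of_le_of_lt (h2.1 i).1 h4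
    refine ⟨⟨⟨?_, ?_⟩, h2, ?_⟩, h4⟩
    · intro m
      by_cases hm : m = i
      · subst hm; exact ⟨hp.le, h1⟩
      · rw [h0 m hm]; exact ⟨le_rfl, (h2.1 m).1.trans (h2.1 m).2⟩
    · intro a b hab
      by_cases ha : a = i
      · right; exact h0 b (fun h => hab (ha.trans h.symm))
      · left; exact h0 a ha
    · rwa [sum_abs_star i h0 (fun m => (h2.1 m).1) h4.le]


lemma starConvex_MA (hr : 0 < r) (hl : ∀ i, r ≤ l i)
    (i : Fin k) : StarConvex ℝ (Pi.single i (l i), 0) (MA l r i) := by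
  intro z hz a b ha hb hab
  rw [mem_MA] at hz ⊢
  obtain ⟨h0, h1, h2, h4, h5⟩ := hz
  have hli := hl i
  refine ⟨?_, ?_, ⟨?_, ?_⟩, ?_, ?_⟩
  · intro m hm
    simp [h0 m hm, hm]
  · simp; nlinarith
  · intro m
    obtain ⟨p1, p2⟩ := h2.1 m
    have := hl m
    simp
    constructor
    · positivity
    · nlinarith
  · intro m n hmn
    rcases h2.2 m n hmn with h | h
    · left; simp [h]
    · right; simp [h]
  · simp
    rcases hb.eq_or_lt with h | h
    · subst h
      have : a = 1 := by linarith
      subst this; simp; linarith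
    · have := mul_lt_mul_of_pos_left h4 h
      have : 0 ≤ a * l i := mul_nonneg ha (by linarith)
      linarith
  · simp [← Finset.mul_sum]
    have q1 := mul_le_mul_of_nonneg_left h5 hb
    have q2 := mul_le_mul_of_nonneg_left hli ha
    have q3 : r = a * r + b * r := by rw [← add_mul, hab, one_mul]
    linarith

lemma sc_MA (hr : 0 < r) (hl : ∀ i, r ≤ l i)
    (i : Fin k) : IsSimplyConnected (MA l r i) := by
  have hc : ((Pi.single i (l i), 0) : (Fin k → ℝ) × (Fin k → ℝ)) ∈ MA l r i := by
    rw [mem_MA]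
    have hli := hl i
    refine ⟨fun m hm => by simp [hm], by simp, ⟨fun m => ?_, fun m n _ => by simp⟩, ?_, ?_⟩
    · have := hl m
      simp; linarith
    · simp; linarith
    · simp; linarith
  have := (starConvex_MA l r hr hl i).contractibleSpace ⟨_, hc⟩
  exact (inferInstance : SimplyConnectedSpace (MA l r i))

lemma MB_eq (i : Fin k) : MB l r i = Prod.swap ⁻¹' (MA l r i) := by
  ext z
  simp only [MA, MB, MConf, mem_ofPred_eq, mem_preimage, Prod.fst_swap, Prod.snd_swap]
  simp only [abs_sub_comm]
  constructor
  · rintro ⟨⟨a, b, c⟩, d⟩; exact ⟨⟨b, a, by simpa only [abs_sub_comm] using c⟩, d⟩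
  · rintro ⟨⟨a, b, c⟩, d⟩; exact ⟨⟨b, a, by simpa only [abs_sub_comm] using c⟩, d⟩

lemma sc_MB (hr : 0 < r) (hl : ∀ i, r ≤ l i)
    (i : Fin k) : IsSimplyConnected (MB l r i) := by
  rw [MB_eq]
  exact ((Homeomorph.prodComm (Fin k → ℝ) (Fin k → ℝ)).isSimplyConnected_preimage).2
    (sc_MA l r hr hl i)

lemma mem_MAB (i j : Fin k) (hij : i ≠ j) (z : (Fin k → ℝ) × (Fin k → ℝ)) (hr : 0 < r)
    (hl : ∀ i, r ≤ l i) :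
    z ∈ MA l r i ∩ MB l r j ↔ (∀ m, m ≠ i → z.1 m = 0) ∧ (∀ m, m ≠ j → z.2 m = 0) ∧
      0 < z.1 i ∧ z.1 i ≤ l i ∧ 0 < z.2 j ∧ z.2 j ≤ l j ∧ r ≤ z.1 i + z.2 j := by
  have key : (∀ m, m ≠ j → z.2 m = 0) → ∑ m, z.2 m = z.2 j := by
    intro h
    exact Finset.sum_eq_single j (fun m _ hm => h m hm) (by simp)
  rw [MB_eq, mem_inter_iff, mem_preimage, mem_MA]
  constructor
  · rintro ⟨⟨a1, a2, a3, a4, a5⟩, b⟩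
    rw [mem_MA] at b
    obtain ⟨b1, b2, b3, b4, b5⟩ := b
    simp only [Prod.fst_swap, Prod.snd_swap] at *
    have e1 := b1 i hij
    have e2 := a1 j hij.symm
    rw [key b1, e1] at a5
    refine ⟨a1, b1, by linarith, a2, by linarith, b2, by linarith⟩
  · rintro ⟨a1, b1, p1, p2, q1, q2, h⟩
    have e1 := b1 i hij
    have e2 := a1 j hij.symm
    have hA : z ∈ MA l r i := by
      rw [mem_MA]
      refine ⟨a1, p2, ⟨?_, ?_⟩, by linarith, by rw [key b1]; linarith⟩
      · intro m
        by_cases hm : m = j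
        · subst hm; exact ⟨q1.le, q2⟩
        · rw [b1 m hm]; exact ⟨le_rfl, hr.le.trans (hl m)⟩
      · intro a b hab
        by_cases ha : a = j
        · right; exact b1 b (fun h => hab (ha.trans h.symm))
        · left; exact b1 a ha
    refine ⟨(mem_MA _ _ _ _).1 hA, ?_⟩
    have : z ∈ MB l r j := ⟨hA.1, by linarith⟩
    rwa [MB_eq] at this

lemma pc_MAB (hr : 0 < r) (hl : ∀ i, r ≤ l i)
    (i j : Fin k) (hij : i ≠ j) : IsPathConnected (MA l r i ∩ MB l r j) := by
  apply Convex.isPathConnected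
  · intro z hz w hw a b ha hb hab
    rw [mem_MAB l r i j hij _ hr hl] at *
    obtain ⟨z1, z2, z3, z4, z5, z6, z7⟩ := hz
    obtain ⟨w1, w2, w3, w4, w5, w6, w7⟩ := hw
    have pos : ∀ s t : ℝ, 0 < s → 0 < t → 0 < a * s + b * t := by
      intro s t hs ht
      rcases ha.eq_or_lt with h | h
      · subst h
        have : b = 1 := by linarith
        subst this; simpa
      · have := mul_pos h hs
        have := mul_nonneg hb ht.le
        linarith
    have le : ∀ s t c : ℝ, s ≤ c → t ≤ c → a * s + b * t ≤ c := by
      intro s t c hs ht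
      have q1 := mul_le_mul_of_nonneg_left hs ha
      have q2 := mul_le_mul_of_nonneg_left ht hb
      have q3 : c = a * c + b * c := by rw [← add_mul, hab, one_mul]
      linarith
    simp only [Prod.fst_add, Prod.snd_add, Prod.smul_fst, Prod.smul_snd, Pi.add_apply,
      Pi.smul_apply, smul_eq_mul]
    refine ⟨fun m hm => by simp [z1 m hm, w1 m hm], fun m hm => by simp [z2 m hm, w2 m hm],
      pos _ _ z3 w3, le _ _ _ z4 w4, pos _ _ z5 w5, le _ _ _ z6 w6, ?_⟩
    have q1 := mul_le_mul_of_nonneg_left z7 ha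
    have q2 := mul_le_mul_of_nonneg_left w7 hb
    have q3 : r = a * r + b * r := by rw [← add_mul, hab, one_mul]
    linarith
  · refine ⟨(Pi.single i (l i), Pi.single j (l j)), ?_⟩
    rw [mem_MAB l r i j hij _ hr hl]
    have := hl i
    have := hl j
    refine ⟨fun m hm => by simp [hm], fun m hm => by simp [hm], ?_, by simp, ?_, by simp, ?_⟩
      <;> simp <;> linarith

lemma bipCover_of_embedding (hr : 0 < r) (hl : ∀ i, r ≤ l i)
    {X : Type} [TopologicalSpace X]
    (F : X → (Fin k → ℝ) × (Fin k → ℝ)) (hF : IsEmbedding F) (hrange : range F = MConf l r) :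
    BipCover X (Fin k) (fun i => {x | (F x).2 i < (F x).1 i})
      (fun i => {x | (F x).1 i < (F x).2 i}) := by
  have hm : ∀ x, F x ∈ MConf l r := fun x => hrange ▸ mem_range_self x
  have hc := hF.continuous
  have c1 : ∀ i, Continuous fun x => (F x).1 i := fun i => (continuous_apply i).comp hc.fst
  have c2 : ∀ i, Continuous fun x => (F x).2 i := fun i => (continuous_apply i).comp hc.snd
  have imA : ∀ i, F '' {x | (F x).2 i < (F x).1 i} = MA l r i := by
    intro i; ext z; constructor
    · rintro ⟨x, hx, rfl⟩; exact ⟨hm x, hx⟩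
    · rintro ⟨h, h'⟩
      rw [← hrange] at h
      obtain ⟨x, rfl⟩ := h
      exact ⟨x, h', rfl⟩
  have imB : ∀ i, F '' {x | (F x).1 i < (F x).2 i} = MB l r i := by
    intro i; ext z; constructor
    · rintro ⟨x, hx, rfl⟩; exact ⟨hm x, hx⟩
    · rintro ⟨h, h'⟩
      rw [← hrange] at h
      obtain ⟨x, rfl⟩ := h
      exact ⟨x, h', rfl⟩
  refine ⟨fun i => isOpen_lt (c2 i) (c1 i), fun i => isOpen_lt (c1 i) (c2 i), ?_, ?_, ?_, ?_, ?_,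
    ?_, ?_⟩
  · intro i j x hi hj
    by_contra hne
    have h1 := ((hm x).2.1.1 i).1
    have h2 := ((hm x).2.1.1 j).1
    simp only [mem_ofPred_eq] at hi hj
    rcases (hm x).1.2 i j hne with h | h <;> linarith
  · intro i j x hi hj
    by_contra hne
    have h1 := ((hm x).1.1 i).1
    have h2 := ((hm x).1.1 j).1
    simp only [mem_ofPred_eq] at hi hj
    rcases (hm x).2.1.2 i j hne with h | h <;> linarith
  · intro i x h h'
    have h1 : (F x).2 i < (F x).1 i := h
    have h2 : (F x).1 i < (F x).2 i := h'
    exact lt_asymm h1 h2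
  · intro x
    by_contra hcon
    push Not at hcon
    have h3 := (hm x).2.2
    rw [Finset.sum_eq_zero] at h3
    · linarith
    · intro i _
      have e1 := hcon.1 i
      have e2 := hcon.2 i
      simp only [mem_ofPred_eq, not_lt] at e1 e2
      rw [le_antisymm e1 e2]; simp
  · intro i j hij
    rw [hF.isInducing.isPathConnected_iff, image_inter hF.injective, imA, imB]
    exact pc_MAB l r hr hl i j hij
  · intro i
    refine ((hF.isSimplyConnected_image).1 ?_).simplyConnectedSpace
    rw [imA]; exact sc_MA l r hr hl i
  · intro i
    refine ((hF.isSimplyConnected_image).1 ?_).simplyConnectedSpace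
    rw [imB]; exact sc_MB l r hr hl i

end Model

section Final
variable {k : ℕ} {L : ℕ → ℝ}

def sEmb (p : StarPt k L) : Fin k → ℝ := fun i => if p.val.1 = i + 1 then p.val.2 else 0

lemma sEmb_sum (p q : StarPt k L) : ∑ i, |sEmb p i - sEmb q i| = dist p q := by
  classical
  obtain ⟨⟨a, s⟩, ha1, ha2, hs1, hs2⟩ := p
  obtain ⟨⟨b, t⟩, hb1, hb2, ht1, ht2⟩ := q
  change _ = starDist _ _
  simp only [starDist, sEmb] at *
  obtain ⟨a, rfl⟩ := Nat.exists_eq_add_of_le' ha1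
  obtain ⟨b, rfl⟩ := Nat.exists_eq_add_of_le' hb1
  set a' : Fin k := ⟨a, by omega⟩ with ha'
  set b' : Fin k := ⟨b, by omega⟩ with hb'
  have ea : ∀ i : Fin k, a + 1 = (i : ℕ) + 1 ↔ a' = i := by
    intro i; rw [Fin.ext_iff]; simp [ha']
  have eb : ∀ i : Fin k, b + 1 = (i : ℕ) + 1 ↔ b' = i := by
    intro i; rw [Fin.ext_iff]; simp [hb']
  simp only [ea, eb]
  by_cases h : a = b
  · subst h
    rw [if_pos rfl, Finset.sum_eq_single a']
    · simp [hb', ha']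
    · intro m _ hm
      simp [hm.symm, hb', ← ha']
    · simp
  · have hne : a' ≠ b' := by simpa [ha', hb'] using h
    rw [if_neg (by omega), ← Finset.add_sum_erase _ _ (Finset.mem_univ a'),
      ← Finset.add_sum_erase _ _ (Finset.mem_erase.2 ⟨hne.symm, Finset.mem_univ b'⟩),
      Finset.sum_eq_zero]
    · simp [hne, hne.symm, abs_of_nonneg hs1, abs_of_nonneg ht1]
    · intro m hm
      simp only [Finset.mem_erase] at hm
      simp [hm.1.symm, hm.2.1.symm]

def lenF (k : ℕ) (L : ℕ → ℝ) : Fin k → ℝ := fun i => L (i + 1)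

noncomputable def qEmb1 : StarGraph k L → PiLp 1 (fun _ : Fin k => ℝ) :=
  SeparationQuotient.lift (fun p => WithLp.toLp 1 (sEmb p)) (by
    intro p q h
    have h' : dist p q = 0 := Metric.inseparable_iff.1 h
    rw [← dist_eq_zero, PiLp.dist_eq_of_L1]
    simpa only [Real.dist_eq, sEmb_sum] using h')

lemma qEmb1_isometry : Isometry (qEmb1 : StarGraph k L → _) := by
  apply Isometry.of_dist_eq
  intro x y
  obtain ⟨p, rfl⟩ := SeparationQuotient.surjective_mk x
  obtain ⟨q, rfl⟩ := SeparationQuotient.surjective_mk y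
  rw [SeparationQuotient.dist_mk, PiLp.dist_eq_of_L1]
  simp only [Real.dist_eq]
  exact sEmb_sum p q

noncomputable def qEmb (x : StarGraph k L) : Fin k → ℝ := WithLp.ofLp (qEmb1 x)

lemma qEmb_mk (p : StarPt k L) : qEmb (SeparationQuotient.mk p) = sEmb p := rfl

lemma qEmb_sum (x y : StarGraph k L) : ∑ i, |qEmb x i - qEmb y i| = dist x y := by
  obtain ⟨p, rfl⟩ := SeparationQuotient.surjective_mk x
  obtain ⟨q, rfl⟩ := SeparationQuotient.surjective_mk y
  rw [SeparationQuotient.dist_mk]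
  exact sEmb_sum p q

lemma qEmb_emb : IsEmbedding (qEmb : StarGraph k L → _) :=
  (PiLp.homeomorph 1 (fun _ : Fin k => ℝ)).isEmbedding.comp qEmb1_isometry.isEmbedding

lemma range_qEmb (hk : 0 < k) (hL : ∀ i, 1 ≤ i → i ≤ k → 0 < L i) :
    range (qEmb : StarGraph k L → _) = MStar (lenF k L) := by
  ext x
  constructor
  · rintro ⟨y, rfl⟩
    obtain ⟨p, rfl⟩ := SeparationQuotient.surjective_mk y
    rw [qEmb_mk]
    obtain ⟨ha1, ha2, hs1, hs2⟩ := p.2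
    refine ⟨fun i => ?_, fun i j hij => ?_⟩
    · simp only [sEmb, lenF]
      split_ifs with h
      · rw [← h]; exact ⟨hs1, hs2⟩
      · exact ⟨le_rfl, (hL _ (by omega) (by omega)).le⟩
    · simp only [sEmb]
      by_cases h : p.val.1 = i + 1
      · right
        rw [if_neg]
        intro h'
        apply hij
        rw [Fin.ext_iff]; omega
      · left; rw [if_neg h]
  · rintro ⟨h1, h2⟩
    by_cases h : ∃ i, x i ≠ 0
    · obtain ⟨i, hi⟩ := h
      have hik := i.2
      refine ⟨SeparationQuotient.mk
        ⟨((i : ℕ) + 1, x i), Nat.le_add_left _ _, hik, (h1 i).1, (h1 i).2⟩, ?_⟩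
      refine (qEmb_mk _).trans ?_
      funext j
      change (if (i : ℕ) + 1 = (j : ℕ) + 1 then x i else 0) = x j
      split_ifs with h
      · have : i = j := by rw [Fin.ext_iff]; omega
        rw [this]
      · have : i ≠ j := fun h' => h (by rw [h'])
        rcases h2 i j this with h3 | h3
        · exact absurd h3 hi
        · exact h3.symm
    · push Not at h
      refine ⟨SeparationQuotient.mk ⟨(1, 0), le_rfl, hk, le_rfl, (hL 1 le_rfl hk).le⟩, ?_⟩
      refine (qEmb_mk _).trans ?_
      funext j
      change (if 1 = (j : ℕ) + 1 then (0 : ℝ) else 0) = x j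
      rw [h j]; simp

noncomputable def cEmb (r : ℝ) (x : ConfigSpace k L r) : (Fin k → ℝ) × (Fin k → ℝ) :=
  (qEmb x.1.1, qEmb x.1.2)

lemma cEmb_emb (r : ℝ) : IsEmbedding (cEmb r : ConfigSpace k L r → _) :=
  (qEmb_emb.prodMap qEmb_emb).comp IsEmbedding.subtypeVal

lemma range_cEmb (r : ℝ) (hk : 0 < k) (hL : ∀ i, 1 ≤ i → i ≤ k → 0 < L i) :
    range (cEmb r : ConfigSpace k L r → _) = MConf (lenF k L) r := by
  ext z
  constructor
  · rintro ⟨⟨⟨x, y⟩, h⟩, rfl⟩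
    refine ⟨?_, ?_, ?_⟩
    · rw [← range_qEmb hk hL]; exact mem_range_self _
    · rw [← range_qEmb hk hL]; exact mem_range_self _
    · exact h.trans (qEmb_sum x y).ge
  · rintro ⟨h1, h2, h3⟩
    rw [← range_qEmb hk hL] at h1 h2
    obtain ⟨x, hx⟩ := h1
    obtain ⟨y, hy⟩ := h2
    rw [← hx, ← hy, qEmb_sum] at h3
    exact ⟨⟨(x, y), h3⟩, Prod.ext hx hy⟩

end Final


end Helpers

/-- if `4 ≤ k` and `0 < r ≤ L i` for every `i ∈ {1,…,k}`, then
`(Star_k)²_{r,L}` is path-connected and its fundamental group at any basepoint is a free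
group on `k² − 3k + 1` generators. -/
theorem configSpace_pi1_free (k : ℕ) (hk : 4 ≤ k) (r : ℝ) (hr : 0 < r) (L : ℕ → ℝ)
    (hLpos : ∀ i, 1 ≤ i → i ≤ k → 0 < L i)
    (hrL : ∀ i, 1 ≤ i → i ≤ k → r ≤ L i) :
    PathConnectedSpace (ConfigSpace k L r) ∧
    ∀ x : ConfigSpace k L r,
      Nonempty (FundamentalGroup (ConfigSpace k L r) x ≃*
        FreeGroup (Fin (k ^ 2 - 3 * k + 1))) := by
  obtain ⟨n, rfl⟩ := Nat.exists_eq_add_of_le' (show 3 ≤ k by omega)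
  have H := bipCover_of_embedding (lenF (n + 3) L) r hr
    (fun i => hrL _ (by omega) (by have := i.2; omega)) (cEmb r) (cEmb_emb r)
    (range_cEmb r (by omega) hLpos)
  have v2 : ((2 : Fin (n+3)) : ℕ) = 2 := Nat.mod_eq_of_lt (a := 2) (b := n + 3) (by omega)
  obtain ⟨hpc, x0, ⟨e⟩⟩ := bip_pi1 H 0 1 2
    (by intro h; have := congrArg Fin.val h; simp at this)
    (by intro h; have := congrArg Fin.val h; rw [v2] at this; simp at this)
    (by intro h; have := congrArg Fin.val h; rw [v2] at this; simp at this)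
  refine ⟨hpc, fun x => ⟨?_⟩⟩
  have : Finite (GenE (0 : Fin (n+3)) 1 2) := inferInstance
  exact (FundamentalGroup.fundamentalGroupMulEquivOfPathConnected x x0).trans
    (e.trans (FreeGroup.freeGroupCongr (Finite.equivFinOfCardEq (card_genE n))))
end

section
/- Let k ≥ 4 and suppose L_2 ≥ L_3 ≥ ⋯ ≥ L_k. If L_4 < r and L_1 < r, then every nonempty path component of the restricted second configuration space (Star_k)^2_{r,L}, regarded as a subspace, is simply connected. -/
noncomputable section StarFlow

def rawDist (p q : ℕ × ℝ) : ℝ := if p.1 = q.1 then |p.2 - q.2| else p.2 + q.2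

/-- signed coordinate along edge `i` -/
def sx (i : ℕ) (p : ℕ × ℝ) : ℝ := if p.1 = i then p.2 else -p.2

/-- unit speed flow towards the end of edge `i` -/
def rawFlow (L : ℕ → ℝ) (i : ℕ) (τ : ℝ) (p : ℕ × ℝ) : ℕ × ℝ :=
  if p.1 = i then (i, min (p.2 + τ) (L i))
  else if τ ≤ p.2 then (p.1, p.2 - τ) else (i, min (τ - p.2) (L i))

theorem sx_lip (i : ℕ) (p q : ℕ × ℝ) (hp : 0 ≤ p.2) (hq : 0 ≤ q.2) :
    |sx i p - sx i q| ≤ rawDist p q := by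
  obtain ⟨a, s⟩ := p
  obtain ⟨b, t⟩ := q
  simp only [sx, rawDist] at *
  rw [abs_le]
  have h1 := le_abs_self (s - t)
  have h2 := neg_le_abs (s - t)
  split_ifs <;> first | (exfalso; omega) | (constructor <;> linarith)

theorem rawFlow_mem {k : ℕ} {L : ℕ → ℝ} {i : ℕ} (hi1 : 1 ≤ i) (hik : i ≤ k) (hL : 0 < L i)
    {τ : ℝ} (hτ : 0 ≤ τ) {p : ℕ × ℝ} (hp : 1 ≤ p.1 ∧ p.1 ≤ k ∧ 0 ≤ p.2 ∧ p.2 ≤ L p.1) :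
    1 ≤ (rawFlow L i τ p).1 ∧ (rawFlow L i τ p).1 ≤ k ∧ 0 ≤ (rawFlow L i τ p).2 ∧
      (rawFlow L i τ p).2 ≤ L (rawFlow L i τ p).1 := by
  obtain ⟨a, s⟩ := p
  simp only [rawFlow] at *
  obtain ⟨h1, h2, h3, h4⟩ := hp
  split_ifs
  · exact ⟨hi1, hik, le_min (by linarith) hL.le, min_le_right _ _⟩
  · exact ⟨h1, h2, by dsimp only; linarith, by dsimp only; linarith⟩
  · exact ⟨hi1, hik, le_min (by linarith) hL.le, min_le_right _ _⟩

theorem rawFlow_lip {L : ℕ → ℝ} {i : ℕ} (hL : 0 < L i)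
    {τ τ' : ℝ} (hτ : 0 ≤ τ) (hτ' : 0 ≤ τ') {p q : ℕ × ℝ}
    (hp : 0 ≤ p.2 ∧ p.2 ≤ L p.1) (hq : 0 ≤ q.2 ∧ q.2 ≤ L q.1) :
    rawDist (rawFlow L i τ p) (rawFlow L i τ' q) ≤ |τ - τ'| + rawDist p q := by
  obtain ⟨a, s⟩ := p
  obtain ⟨b, t⟩ := q
  obtain ⟨h3, h4⟩ := hp
  obtain ⟨h5, h6⟩ := hq
  have h1 := le_abs_self (s - t)
  have h2 := neg_le_abs (s - t)
  have h7 := le_abs_self (τ - τ')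
  have h8 := neg_le_abs (τ - τ')
  have key : ∀ x y : ℝ, |min x (L i) - min y (L i)| ≤ |x - y| := fun x y => by
    simpa using abs_min_sub_min_le_max x (L i) y (L i)
  simp only [rawDist, rawFlow] at *
  by_cases ha : a = i <;> by_cases hb : b = i
  · subst ha hb
    simp only [if_true]
    refine (key _ _).trans ?_
    rw [abs_le]; constructor <;> linarith
  · have hab : a ≠ b := by omega
    rw [if_pos ha, if_neg hb, if_neg hab]
    have hm := min_le_left (s + τ) (L i)
    split_ifs <;> try (exfalso; simp_all; done)
    · simp only; linarith
    · refine (key _ _).trans ?_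
      rw [abs_le]; constructor <;> linarith
  · have hab : a ≠ b := by omega
    rw [if_neg ha, if_pos hb, if_neg hab]
    have hm := min_le_left (t + τ') (L i)
    split_ifs <;> try (exfalso; simp_all; done)
    · simp only; linarith
    · refine (key _ _).trans ?_
      rw [abs_le]; constructor <;> linarith
  · have hm := min_le_left (τ - s) (L i)
    have hm' := min_le_left (τ' - t) (L i)
    have k1 := key (τ - s) (τ' - t)
    have ha' : ¬ i = a := fun h => ha h.symm
    have hb' : ¬ i = b := fun h => hb h.symm
    have k2 : |(τ - s) - (τ' - t)| ≤ |τ - τ'| + |s - t| := by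
      rw [abs_le]; constructor <;> linarith
    have k3 : |(τ - s) - (τ' - t)| ≤ |τ - τ'| + (s + t) ∨ τ ≤ s ∨ τ' ≤ t := by
      by_cases hc : τ ≤ s
      · exact Or.inr (Or.inl hc)
      by_cases hd : τ' ≤ t
      · exact Or.inr (Or.inr hd)
      left
      rw [abs_le]; constructor <;> linarith
    have k4 : |(s - τ) - (t - τ')| ≤ |τ - τ'| + |s - t| := by
      rw [abs_le]; constructor <;> linarith
    rw [if_neg ha, if_neg hb]
    by_cases hab : a = b
    · subst hab
      by_cases hc : τ ≤ s <;> by_cases hd : τ' ≤ t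
      · simpa only [hc, hd, if_true] using k4
      · simp only [hc, hd, if_true, if_false, ha]; linarith
      · simp only [hc, hd, if_true, if_false, ha']; linarith
      · simp only [hc, hd, if_true, if_false]; linarith
    · by_cases hc : τ ≤ s <;> by_cases hd : τ' ≤ t
      · simp only [hc, hd, hab, if_true, if_false]; linarith
      · simp only [hc, hd, hab, if_true, if_false, ha]; linarith
      · simp only [hc, hd, hab, if_true, if_false, hb']; linarith
      · simp only [hc, hd, hab, if_true, if_false]
        rcases k3 with k3 | k3 | k3
        · linarith
        · exact absurd k3 hc
        · exact absurd k3 hd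

theorem rawFlow_zero {L : ℕ → ℝ} {i : ℕ} {p : ℕ × ℝ} (hp : 0 ≤ p.2 ∧ p.2 ≤ L p.1) :
    rawFlow L i 0 p = p := by
  obtain ⟨a, s⟩ := p
  obtain ⟨h1, h2⟩ := hp
  simp only [rawFlow] at *
  split_ifs with h
  · subst h; simp [h2]
  · simp

theorem rawFlow_end {L : ℕ → ℝ} {i : ℕ} {p : ℕ × ℝ} {B : ℝ} (hp : 0 ≤ p.2 ∧ p.2 ≤ B)
    (hL : 0 < L i) (hB : L i ≤ B) :
    rawFlow L i (2 * B) p = (i, L i) := by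
  obtain ⟨a, s⟩ := p
  obtain ⟨h1, h2⟩ := hp
  simp only [rawFlow] at *
  split_ifs with h
  · rw [min_eq_right]; linarith
  · exfalso; linarith
  · rw [min_eq_right]; linarith

/-- the set of configurations flowing to the ends of `(i, j)` -/
def good (L : ℕ → ℝ) (r : ℝ) (i j : ℕ) (p q : ℕ × ℝ) : Prop :=
  (0 ≤ sx i p ∧ 0 ≤ sx j q) ∨ (r ≤ L j ∧ 0 ≤ sx j q ∧ sx j p ≤ sx j q) ∨
    (r ≤ L i ∧ 0 ≤ sx i p ∧ sx i q ≤ sx i p)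

theorem rawDist_comm (p q : ℕ × ℝ) : rawDist p q = rawDist q p := by
  unfold rawDist
  rcases eq_or_ne p.1 q.1 with h | h
  · rw [if_pos h, if_pos h.symm, abs_sub_comm]
  · rw [if_neg h, if_neg h.symm, add_comm]

theorem le_rawDist (i : ℕ) {p q : ℕ × ℝ} {c : ℝ} (hp : 0 ≤ p.2) (hq : 0 ≤ q.2)
    (h : c ≤ sx i p - sx i q) : c ≤ rawDist p q :=
  h.trans ((le_abs_self _).trans (sx_lip i p q hp hq))

theorem sx_rawFlow_self {L : ℕ → ℝ} {i : ℕ} {τ : ℝ} (hτ : 0 ≤ τ) {p : ℕ × ℝ}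
    (hL : 0 < L i) (hp : 0 ≤ p.2) : sx i (rawFlow L i τ p) = min (sx i p + τ) (L i) := by
  obtain ⟨a, s⟩ := p
  simp only [sx, rawFlow] at *
  by_cases ha : a = i
  · simp [ha]
  · by_cases hs : τ ≤ s
    · simp only [ha, hs, if_false, if_true]
      rw [min_eq_left] <;> linarith
    · simp only [ha, hs, if_false, if_true]
      rw [neg_add_eq_sub]

/-- moving towards `i` moves away from `j` no faster than unit speed -/
theorem sx_rawFlow_other {L : ℕ → ℝ} {i j : ℕ} (hij : i ≠ j) {τ : ℝ} (hτ : 0 ≤ τ) {p : ℕ × ℝ}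
    (hL : 0 < L i) (hp : 0 ≤ p.2 ∧ p.2 ≤ L p.1) :
    sx j (rawFlow L i τ p) ≤ max (sx j p) (min (sx j p + τ) 0) := by
  obtain ⟨a, s⟩ := p
  obtain ⟨hp, hpL⟩ := hp
  simp only [sx, rawFlow] at *
  have hm : 0 ≤ min (s + τ) (L i) := le_min (by linarith) hL.le
  have hm1 : s ≤ min (s + τ) (L i) ∨ L i < s := by
    rcases le_total s (L i) with h | h
    · exact Or.inl (le_min (by linarith) h)
    · rcases h.eq_or_lt with h | h
      · exact Or.inl (le_min (by linarith) h.symm.le)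
      · exact Or.inr h
  have hm2 : 0 ≤ min (τ - s) (L i) ∨ τ ≤ s := by
    rcases le_total τ s with h | h
    · exact Or.inr h
    · exact Or.inl (le_min (by linarith) hL.le)
  rw [le_max_iff, le_min_iff]
  split_ifs <;> grind

theorem sx_add_le {a b : ℕ} (hab : a ≠ b) {q : ℕ × ℝ} (hq : 0 ≤ q.2) :
    sx a q + sx b q ≤ 0 := by
  unfold sx
  grind

theorem sx_le {L : ℕ → ℝ} {i : ℕ} {p : ℕ × ℝ} (hL : 0 < L i) (hp : 0 ≤ p.2 ∧ p.2 ≤ L p.1) :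
    sx i p ≤ L i := by
  unfold sx
  grind

theorem rawDist_eq {j : ℕ} {p q : ℕ × ℝ} (hp : 0 ≤ p.2) (hq : 0 ≤ q.2) (h : 0 ≤ sx j q) :
    rawDist p q = |sx j p - sx j q| := by
  obtain ⟨a, s⟩ := p
  obtain ⟨b, t⟩ := q
  simp only [sx, rawDist] at *
  grind

theorem good_swap {L : ℕ → ℝ} {r : ℝ} {i j : ℕ} {p q : ℕ × ℝ} (h : good L r i j p q) :
    good L r j i q p := by
  unfold good at *
  tauto

theorem good_flow_aux {L : ℕ → ℝ} {r : ℝ} {i j : ℕ} (hij : i ≠ j) (hi : 0 < L i) (hj : 0 < L j)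
    {p q : ℕ × ℝ} {τ : ℝ} (hτ : 0 ≤ τ)
    (hp : 0 ≤ p.2 ∧ p.2 ≤ L p.1) (hq : 0 ≤ q.2 ∧ q.2 ≤ L q.1)
    (hp' : 0 ≤ (rawFlow L i τ p).2) (hq' : 0 ≤ (rawFlow L j τ q).2)
    (h1 : r ≤ L j) (h2 : 0 ≤ sx j q) (h3 : sx j p ≤ sx j q) (hd : r ≤ rawDist p q) :
    r ≤ rawDist (rawFlow L i τ p) (rawFlow L j τ q) := by
  rw [rawDist_comm]
  apply le_rawDist j hq' hp'
  rw [rawDist_eq hp.1 hq.1 h2, abs_sub_comm, abs_of_nonneg (by linarith)] at hd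
  rw [sx_rawFlow_self hτ hj hq.1]
  have := sx_rawFlow_other hij hτ hi hp
  have h4 := sx_le hj hq
  grind

theorem good_flow {L : ℕ → ℝ} {r : ℝ} {i j : ℕ} (hij : i ≠ j) (hi : 0 < L i) (hj : 0 < L j)
    {p q : ℕ × ℝ} {τ : ℝ} (hτ : 0 ≤ τ)
    (hp : 0 ≤ p.2 ∧ p.2 ≤ L p.1) (hq : 0 ≤ q.2 ∧ q.2 ≤ L q.1)
    (hp' : 0 ≤ (rawFlow L i τ p).2) (hq' : 0 ≤ (rawFlow L j τ q).2)
    (hg : good L r i j p q) (hd : r ≤ rawDist p q) :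
    r ≤ rawDist (rawFlow L i τ p) (rawFlow L j τ q) := by
  rcases hg with ⟨h1, h2⟩ | ⟨h1, h2, h3⟩ | ⟨h1, h2, h3⟩
  · apply le_rawDist i hp' hq'
    have e1 := sx_rawFlow_self hτ hi hp.1
    have e2 := sx_rawFlow_self hτ hj hq.1
    have e3 := sx_add_le hij hq'
    have e4 := sx_add_le hij hp.1
    have e5 := sx_le hj hq
    have e6 := sx_le hi hp
    have e7 : |sx i p| = |sx j p| := by unfold sx; grind
    rw [rawDist_eq hp.1 hq.1 h2] at hd
    grind
  · exact good_flow_aux hij hi hj hτ hp hq hp' hq' h1 h2 h3 hd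
  · rw [rawDist_comm] at hd ⊢
    exact good_flow_aux hij.symm hj hi hτ hq hp hq' hp' h1 h2 h3 hd

/-- the index set of classes -/
def idx (k : ℕ) (L : ℕ → ℝ) (r : ℝ) (i j : ℕ) : Prop :=
  1 ≤ i ∧ i ≤ k ∧ 1 ≤ j ∧ j ≤ k ∧ i ≠ j ∧
    ((L i < r ∧ L j < r) ∨ (i = 3 ∧ j = 2) ∨ (i = 2 ∧ j = 3))

theorem good_cover {k : ℕ} (hk : 4 ≤ k) {L : ℕ → ℝ} {r : ℝ} (hr : 0 < r)
    (hs : ∀ i, 1 ≤ i → i ≤ k → i ≠ 2 → i ≠ 3 → L i < r) {p q : ℕ × ℝ}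
    (hp : 1 ≤ p.1 ∧ p.1 ≤ k ∧ 0 ≤ p.2 ∧ p.2 ≤ L p.1)
    (hq : 1 ≤ q.1 ∧ q.1 ≤ k ∧ 0 ≤ q.2 ∧ q.2 ≤ L q.1) (hd : r ≤ rawDist p q) :
    ∃ i j, idx k L r i j ∧ good L r i j p q := by
  obtain ⟨a, s⟩ := p
  obtain ⟨b, t⟩ := q
  have ha := hs a
  have hb := hs b
  simp only [rawDist, idx, good, sx] at *
  by_cases h : (L a < r ∧ L b < r)
  · refine ⟨a, b, ?_, ?_⟩ <;> grind
  · by_cases h2 : ((b = 2 ∧ r ≤ L 2 ∧ (a = 2 → s ≤ t)) ∨ (a = 3 ∧ r ≤ L 3 ∧ (b = 3 → t ≤ s)))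
    · refine ⟨3, 2, ?_, ?_⟩
      · grind
      · grind
    · refine ⟨2, 3, ?_, ?_⟩
      · grind
      · grind

theorem good_short {L : ℕ → ℝ} {r : ℝ} {p q : ℕ × ℝ}
    (hp : 0 ≤ p.2 ∧ p.2 ≤ L p.1)
    (hq : 0 ≤ q.2 ∧ q.2 ≤ L q.1) (hd : r ≤ rawDist p q) {i j : ℕ}
    (hi : L i < r) (hj : L j < r) (hr : 0 < r) (hg : good L r i j p q) :
    p.1 = i ∧ q.1 = j ∧ 0 < p.2 ∧ 0 < q.2 := by
  have hg : 0 ≤ sx i p ∧ 0 ≤ sx j q := by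
    rcases hg with h | h | h
    · exact h
    · linarith [h.1]
    · linarith [h.1]
  obtain ⟨a, s⟩ := p
  obtain ⟨b, t⟩ := q
  simp only [rawDist, sx] at *
  grind

theorem good_short_long {L : ℕ → ℝ} {r : ℝ} {p q : ℕ × ℝ}
    (hp : L p.1 < r) (hq : L q.1 < r) (hp' : 0 < p.2) (hq' : 0 < q.2) {i j : ℕ}
    (hl : r ≤ L i ∨ r ≤ L j) (hg : good L r i j p q) : False := by
  obtain ⟨a, s⟩ := p
  obtain ⟨b, t⟩ := q
  simp only [good, sx] at *
  have e1 : r ≤ L i → ¬ a = i := by rintro h rfl; linarith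
  have e2 : r ≤ L j → ¬ b = j := by rintro h rfl; linarith
  rcases hg with h | h | h
  · grind
  · grind
  · grind

theorem good_long_long {L : ℕ → ℝ} {r : ℝ} {p q : ℕ × ℝ} (hr : 0 < r)
    (hp : 0 ≤ p.2 ∧ p.2 ≤ L p.1)
    (hq : 0 ≤ q.2 ∧ q.2 ≤ L q.1) (hd : r ≤ rawDist p q) {i j : ℕ} (hij : i ≠ j)
    (hsp : p.1 ≠ i → p.1 ≠ j → L p.1 < r) (hsq : q.1 ≠ i → q.1 ≠ j → L q.1 < r)
    (hg : good L r i j p q) (hg' : good L r j i p q) : False := by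
  obtain ⟨a, s⟩ := p
  obtain ⟨b, t⟩ := q
  simp only [good, sx, rawDist] at *
  have hab : a = b ∨ ¬ a = b := em _
  rcases hab with hab | hab
  · subst hab
    rw [if_pos rfl] at hd
    have hst : s ≠ t := by rintro rfl; simp at hd; linarith
    rcases eq_or_ne a i with rfl | h1
    · rw [if_neg hij, if_neg hij] at *
      rcases hg with h | h | h <;> rcases hg' with h' | h' | h' <;>
        grind
    · rcases eq_or_ne a j with rfl | h2
      · rw [if_neg h1, if_neg h1] at *
        rcases hg with h | h | h <;> rcases hg' with h' | h' | h' <;>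
          grind
      · rw [if_neg h1, if_neg h1, if_neg h2, if_neg h2] at *
        rcases hg with h | h | h <;> rcases hg' with h' | h' | h' <;> grind
  · rw [if_neg hab] at hd
    rcases hg with h | h | h <;> rcases hg' with h' | h' | h' <;> grind

theorem good_disj {k : ℕ} {L : ℕ → ℝ} {r : ℝ} (hr : 0 < r) {p q : ℕ × ℝ}
    (h32 : L 3 ≤ L 2)
    (hsp : p.1 ≠ 2 → p.1 ≠ 3 → L p.1 < r) (hsq : q.1 ≠ 2 → q.1 ≠ 3 → L q.1 < r)
    (hp : 0 ≤ p.2 ∧ p.2 ≤ L p.1)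
    (hq : 0 ≤ q.2 ∧ q.2 ≤ L q.1) (hd : r ≤ rawDist p q) {i j i' j' : ℕ}
    (h : idx k L r i j) (h' : idx k L r i' j') (hg : good L r i j p q)
    (hg' : good L r i' j' p q) : i = i' ∧ j = j' := by
  obtain ⟨-, -, -, -, hne, h⟩ := h
  obtain ⟨-, -, -, -, hne', h'⟩ := h'
  by_cases c : L i < r ∧ L j < r
  · obtain ⟨a1, a2, a3, a4⟩ := good_short hp hq hd c.1 c.2 hr hg
    by_cases c' : L i' < r ∧ L j' < r
    · obtain ⟨b1, b2, b3, b4⟩ := good_short hp hq hd c'.1 c'.2 hr hg'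
      exact ⟨a1.symm.trans b1, a2.symm.trans b2⟩
    · refine (good_short_long (a1 ▸ c.1) (a2 ▸ c.2) a3 a4 ?_ hg').elim
      grind
  · by_cases c' : L i' < r ∧ L j' < r
    · obtain ⟨b1, b2, b3, b4⟩ := good_short hp hq hd c'.1 c'.2 hr hg'
      refine (good_short_long (b1 ▸ c'.1) (b2 ▸ c'.2) b3 b4 ?_ hg).elim
      grind
    · by_contra hcon
      have : i' = j ∧ j' = i := by grind
      obtain ⟨rfl, rfl⟩ := this
      exact good_long_long hr hp hq hd hne (by grind) (by grind) hg hg'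

end StarFlow
noncomputable section StarTop

variable {k : ℕ} {L : ℕ → ℝ} {r : ℝ}

def rep (a : StarGraph k L) : StarPt k L :=
  Function.surjInv SeparationQuotient.surjective_mk a

theorem mk_rep (a : StarGraph k L) : SeparationQuotient.mk (rep a) = a :=
  Function.surjInv_eq SeparationQuotient.surjective_mk a

theorem dist_mk_raw (p q : StarPt k L) :
    dist (SeparationQuotient.mk p) (SeparationQuotient.mk q) = rawDist p.val q.val := by
  rw [SeparationQuotient.dist_mk]
  rfl

theorem dist_rep (a b : StarGraph k L) : rawDist (rep a).val (rep b).val = dist a b := by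
  rw [← dist_mk_raw, mk_rep, mk_rep]

theorem continuous_sx (i : ℕ) : Continuous fun a : StarGraph k L => sx i (rep a).val := by
  refine (LipschitzWith.of_dist_le_mul (K := 1) fun a b => ?_).continuous
  rw [Real.dist_eq, NNReal.coe_one, one_mul, ← dist_rep]
  exact sx_lip i _ _ (rep a).prop.2.2.1 (rep b).prop.2.2.1

def flowG (i : ℕ) (hi : 1 ≤ i ∧ i ≤ k ∧ 0 < L i) (τ : ℝ) (a : StarGraph k L) : StarGraph k L :=
  SeparationQuotient.mk ⟨rawFlow L i (max τ 0) (rep a).val,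
    rawFlow_mem hi.1 hi.2.1 hi.2.2 (le_max_right _ _) (rep a).prop⟩

theorem dist_flowG (i j : ℕ) (hi : 1 ≤ i ∧ i ≤ k ∧ 0 < L i) (hj : 1 ≤ j ∧ j ≤ k ∧ 0 < L j)
    (τ τ' : ℝ) (a b : StarGraph k L) : dist (flowG i hi τ a) (flowG j hj τ' b) =
      rawDist (rawFlow L i (max τ 0) (rep a).val) (rawFlow L j (max τ' 0) (rep b).val) :=
  dist_mk_raw _ _

theorem continuous_flowG (i : ℕ) (hi : 1 ≤ i ∧ i ≤ k ∧ 0 < L i) :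
    Continuous fun x : ℝ × StarGraph k L => flowG i hi x.1 x.2 := by
  refine (LipschitzWith.of_dist_le_mul (K := 2) fun x y => ?_).continuous
  have h1 := rawFlow_lip hi.2.2 (le_max_right x.1 0) (le_max_right y.1 0)
    (rep x.2).prop.2.2 (rep y.2).prop.2.2
  have h2 : |max x.1 0 - max y.1 0| ≤ |x.1 - y.1| := by
    simpa using abs_max_sub_max_le_max x.1 0 y.1 0
  have h3 : |x.1 - y.1| ≤ dist x y := by
    rw [← Real.dist_eq, Prod.dist_eq]; exact le_max_left _ _
  have h4 : dist x.2 y.2 ≤ dist x y := by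
    rw [Prod.dist_eq]; exact le_max_right _ _
  rw [dist_rep] at h1
  rw [dist_flowG, NNReal.coe_ofNat]
  linarith

theorem flowG_zero (i : ℕ) (hi : 1 ≤ i ∧ i ≤ k ∧ 0 < L i) (a : StarGraph k L) :
    flowG i hi 0 a = a := by
  conv_rhs => rw [← mk_rep a]
  unfold flowG
  congr 1
  apply Subtype.ext
  simp only [max_self]
  exact rawFlow_zero (rep a).prop.2.2

theorem flowG_end (i : ℕ) (hi : 1 ≤ i ∧ i ≤ k ∧ 0 < L i) {B : ℝ}
    (hB : ∀ j, 1 ≤ j → j ≤ k → L j ≤ B) (a : StarGraph k L) :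
    flowG i hi (2 * B) a =
      SeparationQuotient.mk ⟨(i, L i), hi.1, hi.2.1, hi.2.2.le, le_rfl⟩ := by
  unfold flowG
  congr 1
  apply Subtype.ext
  have h := hB i hi.1 hi.2.1
  have h0 := hi.2.2
  have hp := (rep a).prop
  simp only [max_eq_left (show (0 : ℝ) ≤ 2 * B by linarith)]
  exact rawFlow_end ⟨hp.2.2.1, hp.2.2.2.trans (hB _ hp.1 hp.2.1)⟩ h0 h

/-- the class of configurations -/
def cls (k : ℕ) (L : ℕ → ℝ) (r : ℝ) (i j : ℕ) : Set (ConfigSpace k L r) :=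
  {y | idx k L r i j ∧ good L r i j (rep y.1.1).val (rep y.1.2).val}

theorem isClosed_cls (i j : ℕ) : IsClosed (cls k L r i j) := by
  have c1 : ∀ n, Continuous fun y : ConfigSpace k L r => sx n (rep y.1.1).val := fun n =>
    (continuous_sx n).comp (continuous_fst.comp continuous_subtype_val)
  have c2 : ∀ n, Continuous fun y : ConfigSpace k L r => sx n (rep y.1.2).val := fun n =>
    (continuous_sx n).comp (continuous_snd.comp continuous_subtype_val)
  have cc : ∀ P : Prop, IsClosed {_y : ConfigSpace k L r | P} := fun P => isClosed_const
  unfold cls good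
  simp only [Set.ofPred_and, Set.ofPred_or]
  exact (cc _).inter (((isClosed_le continuous_const (c1 i)).inter
    (isClosed_le continuous_const (c2 j))).union (((cc _).inter
    ((isClosed_le continuous_const (c2 j)).inter (isClosed_le (c1 j) (c2 j)))).union ((cc _).inter
    ((isClosed_le continuous_const (c1 i)).inter (isClosed_le (c2 i) (c1 i))))))

theorem rep_dist (y : ConfigSpace k L r) : r ≤ rawDist (rep y.1.1).val (rep y.1.2).val := by
  rw [dist_rep]; exact y.2

theorem isOpen_cls (hk : 4 ≤ k) (hr : 0 < r)
    (hs : ∀ i, 1 ≤ i → i ≤ k → i ≠ 2 → i ≠ 3 → L i < r) (h32 : L 3 ≤ L 2) (i j : ℕ) :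
    IsOpen (cls k L r i j) := by
  have hfin : Finite {c : Fin (k + 1) × Fin (k + 1) // ((c.1 : ℕ), (c.2 : ℕ)) ≠ (i, j)} :=
    inferInstance
  have hcl : IsClosed (⋃ c : {c : Fin (k + 1) × Fin (k + 1) // ((c.1 : ℕ), (c.2 : ℕ)) ≠ (i, j)},
      cls k L r c.1.1 c.1.2) := isClosed_iUnion_of_finite fun c => isClosed_cls _ _
  by_cases hidx : idx k L r i j
  · convert hcl.isOpen_compl using 1
    ext y
    have hp := (rep y.1.1).prop
    have hq := (rep y.1.2).prop
    simp only [Set.mem_compl_iff, Set.mem_iUnion, not_exists]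
    constructor
    · rintro hy ⟨c, hc⟩ hyc
      apply hc
      have := good_disj hr h32 (hs _ hp.1 hp.2.1) (hs _ hq.1 hq.2.1) hp.2.2 hq.2.2 (rep_dist y)
        hyc.1 hy.1 hyc.2 hy.2
      exact Prod.ext this.1 this.2
    · intro hy
      obtain ⟨i', j', h1, h2⟩ := good_cover hk hr hs hp hq (rep_dist y)
      by_cases he : (i', j') = (i, j)
      · obtain ⟨rfl, rfl⟩ := Prod.mk.inj he
        exact ⟨h1, h2⟩
      · exact (hy ⟨(⟨i', by have := h1.2.1; omega⟩, ⟨j', by have := h1.2.2.2.1; omega⟩), he⟩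
          ⟨h1, h2⟩).elim
  · have : cls k L r i j = ∅ := by
      ext y; simp [cls, hidx]
    rw [this]; exact isOpen_empty

theorem main_aux (hk : 4 ≤ k) (hr : 0 < r) (hpos : ∀ i, 1 ≤ i → i ≤ k → 0 < L i)
    (hs : ∀ i, 1 ≤ i → i ≤ k → i ≠ 2 → i ≠ 3 → L i < r) (h32 : L 3 ≤ L 2)
    (x : ConfigSpace k L r) : ContractibleSpace (pathComponent x) := by
  obtain ⟨i, j, hij, hg⟩ := good_cover hk hr hs (rep x.1.1).prop (rep x.1.2).prop (rep_dist x)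
  have hsub : pathComponent x ⊆ cls k L r i j :=
    (isPathConnected_pathComponent).isConnected.isPreconnected.subset_isClopen
      ⟨isClosed_cls i j, isOpen_cls hk hr hs h32 i j⟩ ⟨x, mem_pathComponent_self x, hij, hg⟩
  obtain ⟨hi1, hi2, hj1, hj2, hne, -⟩ := id hij
  have hi := hpos i hi1 hi2
  have hj := hpos j hj1 hj2
  let B : ℝ := ∑ n ∈ Finset.Icc 1 k, L n
  have hB : ∀ n, 1 ≤ n → n ≤ k → L n ≤ B := fun n h1 h2 =>
    Finset.single_le_sum (f := L)
      (fun m hm => (hpos m (Finset.mem_Icc.1 hm).1 (Finset.mem_Icc.1 hm).2).le)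
      (Finset.mem_Icc.2 ⟨h1, h2⟩)
  -- the homotopy with values in the configuration space
  let F : unitInterval × pathComponent x → ConfigSpace k L r := fun uy =>
    ⟨(flowG i ⟨hi1, hi2, hi⟩ ((uy.1 : ℝ) * (2 * B)) uy.2.1.1.1,
      flowG j ⟨hj1, hj2, hj⟩ ((uy.1 : ℝ) * (2 * B)) uy.2.1.1.2), by
      have hy := hsub uy.2.2
      rw [dist_flowG]
      exact good_flow hne hi hj (le_max_right _ _) (rep _).prop.2.2 (rep _).prop.2.2
        (rawFlow_mem hi1 hi2 hi (le_max_right _ _) (rep _).prop).2.2.1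
        (rawFlow_mem hj1 hj2 hj (le_max_right _ _) (rep _).prop).2.2.1 hy.2 (rep_dist _)⟩
  have hF : Continuous F := by
    apply Continuous.subtype_mk
    apply Continuous.prodMk
    · exact (continuous_flowG i ⟨hi1, hi2, hi⟩).comp (by fun_prop : Continuous
        fun uy : unitInterval × pathComponent x => ((uy.1 : ℝ) * (2 * B), uy.2.1.1.1))
    · exact (continuous_flowG j ⟨hj1, hj2, hj⟩).comp (by fun_prop : Continuous
        fun uy : unitInterval × pathComponent x => ((uy.1 : ℝ) * (2 * B), uy.2.1.1.2))
  have hF0 : ∀ y, F (0, y) = y.1 := fun y => by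
    apply Subtype.ext
    simp only [F, Set.Icc.coe_zero, zero_mul, flowG_zero]
  have hF1 : ∀ y z, F (1, y) = F (1, z) := fun y z => by
    apply Subtype.ext
    simp only [F, Set.Icc.coe_one, one_mul, flowG_end _ _ hB]
  have hmem : ∀ uy, F uy ∈ pathComponent x := by
    rintro ⟨u, y⟩
    have h1 : Joined y.1 (F (u, y)) := by
      rw [← hF0 y]
      have h2 : Joined (0 : unitInterval) u := by
        have : PathConnectedSpace unitInterval := isPathConnected_iff_pathConnectedSpace.1
          ((convex_Icc (0 : ℝ) 1).isPathConnected ⟨0, by simp⟩)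
        exact PathConnectedSpace.joined _ _
      obtain ⟨γ⟩ := h2
      exact ⟨γ.map (f := fun v => F (v, y)) (hF.comp (by fun_prop))⟩
    exact Joined.trans y.2 h1
  have y0 : pathComponent x := ⟨x, mem_pathComponent_self x⟩
  rw [contractible_iff_id_nullhomotopic]
  refine ⟨⟨F (1, y0), hmem _⟩, ⟨⟨⟨fun uy => ⟨F uy, hmem uy⟩, hF.subtype_mk _⟩, ?_, ?_⟩⟩⟩
  · intro y
    exact Subtype.ext (hF0 y)
  · intro y
    exact Subtype.ext (hF1 y y0)

end StarTop

/-- if `4 ≤ k`, `L 2 ≥ L 3 ≥ ⋯ ≥ L k`, `L 4 < r` and `L 1 < r`, then every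
nonempty path component of `(Star_k)²_{r,L}` is simply connected. -/
theorem configSpace_components_simplyConnected' (k : ℕ) (hk : 4 ≤ k) (r : ℝ) (hr : 0 < r)
    (L : ℕ → ℝ) (hLpos : ∀ i, 1 ≤ i → i ≤ k → 0 < L i)
    (hmono : ∀ i j, 2 ≤ i → i ≤ j → j ≤ k → L j ≤ L i)
    (hL4 : L 4 < r) (hL1 : L 1 < r) :
    ∀ x : ConfigSpace k L r, SimplyConnectedSpace (pathComponent x) := by
  intro x
  have hs : ∀ i, 1 ≤ i → i ≤ k → i ≠ 2 → i ≠ 3 → L i < r := by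
    intro i h1 h2 h3 h4
    rcases eq_or_ne i 1 with rfl | h5
    · exact hL1
    · exact (hmono 4 i (by norm_num) (by omega) h2).trans_lt hL4
  have := main_aux hk hr hLpos hs (hmono 2 3 le_rfl (by norm_num) (by omega)) x
  infer_instance
end

section
/- Let k ≥ 4, suppose L_2 ≥ L_3 ≥ ⋯ ≥ L_k, L_4 < r ≤ L_3, and r ≤ L_1. Then the restricted second configuration space (Star_k)^2_{r,L} has exactly (k−3)(k−4) + 1 − 2h path components; exactly one of these path components is not simply connected, and the fundamental group of that component (at any of its points) is an infinite cyclic group, i.e., isomorphic to ℤ. -/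
/-- The number `h` of unordered pairs `{i,j} ⊆ {1,…,k}` with `i ≠ j` and `L i + L j < r`,
counted via representatives `i < j`. -/
noncomputable def pairCount (k : ℕ) (r : ℝ) (L : ℕ → ℝ) : ℕ :=
  Set.ncard {p : ℕ × ℕ | 1 ≤ p.1 ∧ p.1 < p.2 ∧ p.2 ≤ k ∧ L p.1 + L p.2 < r}

open CategoryTheory ContinuousMap

theorem pi1_puncture (z : {z : ℂ // z ≠ 0}) :
    Nonempty (FundamentalGroup {z : ℂ // z ≠ 0} z ≃* Multiplicative ℤ) := by
  obtain ⟨w, hw⟩ : ∃ w : ℂ, Complex.exp w = z := ⟨Complex.log z, Complex.exp_log z.2⟩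
  let e1 := Complex.isAddQuotientCoveringMap_exp.fundamentalGroupEquiv (x := z)
    ⟨w, Subtype.ext hw⟩
  refine ⟨e1.trans ?_⟩
  let e2 : AddSubgroup.zmultiples (2 * Real.pi * Complex.I) ≃+ ℤ := by
    refine AddEquiv.symm ?_
    refine AddEquiv.ofBijective ((zmultiplesHom ℂ (2 * Real.pi * Complex.I)).rangeRestrict) ⟨?_, ?_⟩
    · refine (AddMonoidHom.rangeRestrict_injective_iff).mpr ?_
      intro a b h
      have h2 : (2 * Real.pi * Complex.I : ℂ) ≠ 0 := Complex.two_pi_I_ne_zero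
      simpa [h2] using h
    · exact AddMonoidHom.rangeRestrict_surjective _
  exact (MulOpposite.opMulEquiv (M := Multiplicative _)).symm.trans (AddEquiv.toMultiplicative e2)

theorem pi1_of_hequiv {X Y : Type*} [TopologicalSpace X] [TopologicalSpace Y] (e : X ≃ₕ Y) (x : X) :
    Nonempty (FundamentalGroup X x ≃* FundamentalGroup Y (e x)) := by
  let F := (FundamentalGroupoidFunctor.equivOfHomotopyEquiv e)
  exact ⟨F.fullyFaithfulFunctor.mulEquivEnd (FundamentalGroupoid.mk x)⟩

theorem pathConnected_of_hequiv {X Y : Type*} [TopologicalSpace X] [TopologicalSpace Y] (e : X ≃ₕ Y)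
    [PathConnectedSpace Y] : PathConnectedSpace X := by
  obtain ⟨H⟩ := e.left_inv
  refine ⟨⟨e.invFun (Classical.arbitrary Y)⟩, fun x y => ?_⟩
  have h : ∀ x, Joined (e.invFun (e.toFun x)) x := fun x => ⟨H.evalAt x⟩
  refine (h x).symm.trans (Joined.trans ?_ (h y))
  exact ((PathConnectedSpace.joined (e.toFun x) (e.toFun y)).map e.invFun.continuous)

theorem components_general {X ι : Type*} [TopologicalSpace X] (A : ι → Set X)
    (hopen : ∀ i, IsOpen (A i)) (hcov : ∀ x, ∃ i, x ∈ A i)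
    (hdis : ∀ i j x, x ∈ A i → x ∈ A j → i = j)
    (hpc : ∀ i, PathConnectedSpace (A i)) :
    Nat.card (ZerothHomotopy X) = Nat.card ι ∧ ∀ i, ∀ x ∈ A i, pathComponent x = A i := by
  have hclosed : ∀ i, IsClosed (A i) := by
    intro i
    have : A i = (⋃ j : {j // j ≠ i}, A j)ᶜ := by
      ext x
      obtain ⟨j, hj⟩ := hcov x
      simp only [Set.mem_compl_iff, Set.mem_iUnion, not_exists]
      constructor
      · intro h j' hj'
        exact j'.2 (hdis _ _ _ hj' h)
      · intro h
        by_cases hji : j = i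
        · exact hji ▸ hj
        · exact absurd hj (h ⟨j, hji⟩)
    rw [this]
    exact (isOpen_iUnion fun j => hopen _).isClosed_compl
  have hcomp : ∀ i, ∀ x ∈ A i, pathComponent x = A i := by
    intro i x hx
    apply Set.Subset.antisymm
    · refine (pathComponent_subset_component x).trans ?_
      exact IsClopen.connectedComponent_subset ⟨hclosed i, hopen i⟩ hx
    · exact (isPathConnected_iff_pathConnectedSpace.mpr (hpc i)).subset_pathComponent hx
  refine ⟨?_, hcomp⟩
  choose c hc using hcov
  have hj : ∀ x y, Joined x y ↔ c x = c y := by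
    intro x y
    have : Joined x y ↔ y ∈ pathComponent x := Iff.rfl
    rw [this, hcomp _ _ (hc x)]
    exact ⟨fun h => hdis _ _ _ h (hc y), fun h => h ▸ hc y⟩
  refine Nat.card_eq_of_bijective (Quotient.lift c fun x y h => (hj x y).1 h) ⟨?_, ?_⟩
  · intro a b
    induction a using Quotient.inductionOn
    induction b using Quotient.inductionOn
    intro h
    exact Quotient.sound ((hj _ _).2 h)
  · intro i
    obtain ⟨x⟩ := (hpc i).nonempty
    exact ⟨Quotient.mk _ x.1, hdis _ _ _ (hc _) x.2⟩
open Topology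

/-- Coordinates of a point of the star. -/
noncomputable def sV {k : ℕ} {L : ℕ → ℝ} (x : StarPt k L) : ℕ → ℝ := Pi.single x.val.1 x.val.2

theorem dist_sV {k : ℕ} {L : ℕ → ℝ} (x y : StarPt k L) :
    dist x y = ∑ n ∈ Finset.Icc 1 k, |sV x n - sV y n| := by
  change starDist x y = _
  obtain ⟨⟨i, s⟩, hi1, hik, hs, hs'⟩ := x
  obtain ⟨⟨j, t⟩, hj1, hjk, ht, ht'⟩ := y
  simp only [starDist, sV] at *
  split_ifs with h
  · subst h
    rw [Finset.sum_eq_single i]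
    · simp
    · intro n _ hn; simp [hn]
    · intro hn; simp at hn; omega
  · have : ∀ n ∈ Finset.Icc 1 k, |(Pi.single i s : ℕ → ℝ) n - (Pi.single j t : ℕ → ℝ) n|
        = (Pi.single i s : ℕ → ℝ) n + (Pi.single j t : ℕ → ℝ) n := by
      intro n _
      simp only [Pi.single_apply]
      split_ifs <;> simp_all
    rw [Finset.sum_congr rfl this, Finset.sum_add_distrib]
    simp only [Pi.single_apply, Finset.sum_ite_eq', Finset.mem_Icc]
    rw [if_pos ⟨hi1, hik⟩, if_pos ⟨hj1, hjk⟩]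

theorem sV_eq_of_dist {k : ℕ} {L : ℕ → ℝ} (x y : StarPt k L) (h : dist x y = 0) : sV x = sV y := by
  rw [dist_sV, Finset.sum_eq_zero_iff_of_nonneg (fun _ _ => abs_nonneg _)] at h
  funext n
  by_cases hn : n ∈ Finset.Icc 1 k
  · have := h n hn
    rwa [abs_eq_zero, sub_eq_zero] at this
  · obtain ⟨⟨i, s⟩, hi1, hik, hs, hs'⟩ := x
    obtain ⟨⟨j, t⟩, hj1, hjk, ht, ht'⟩ := y
    simp only [Finset.mem_Icc] at *
    have h1 : n ≠ i := by rintro rfl; exact hn ⟨hi1, hik⟩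
    have h2 : n ≠ j := by rintro rfl; exact hn ⟨hj1, hjk⟩
    simp [sV, h1, h2]

/-- Coordinates on the star graph. -/
noncomputable def emb {k : ℕ} {L : ℕ → ℝ} : StarGraph k L → (ℕ → ℝ) :=
  SeparationQuotient.lift sV fun x y h => sV_eq_of_dist x y (Metric.inseparable_iff.1 h)

theorem dist_emb {k : ℕ} {L : ℕ → ℝ} (x y : StarGraph k L) :
    dist x y = ∑ n ∈ Finset.Icc 1 k, |emb x n - emb y n| := by
  obtain ⟨x, rfl⟩ := SeparationQuotient.surjective_mk x
  obtain ⟨y, rfl⟩ := SeparationQuotient.surjective_mk y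
  rw [SeparationQuotient.dist_mk]
  exact dist_sV x y

theorem emb_embedding {k : ℕ} {L : ℕ → ℝ} : IsEmbedding (emb : StarGraph k L → (ℕ → ℝ)) := by
  have hinj : Function.Injective (emb : StarGraph k L → (ℕ → ℝ)) := by
    intro x y h
    apply eq_of_dist_eq_zero
    rw [dist_emb, h]; simp
  have hcont : Continuous (emb : StarGraph k L → (ℕ → ℝ)) := by
    refine continuous_pi fun n => ?_
    by_cases hn : n ∈ Finset.Icc 1 k
    · refine LipschitzWith.continuous (K := 1) (LipschitzWith.of_dist_le_mul fun x y => ?_)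
      rw [dist_emb, Real.dist_eq]
      simpa using Finset.single_le_sum (f := fun n => |emb x n - emb y n|)
        (fun _ _ => abs_nonneg _) hn
    · have : (fun x : StarGraph k L => emb x n) = fun _ => 0 := by
        funext x
        obtain ⟨x, rfl⟩ := SeparationQuotient.surjective_mk x
        obtain ⟨⟨i, s⟩, hi1, hik, hs, hs'⟩ := x
        have h1 : n ≠ i := by rintro rfl; exact hn (Finset.mem_Icc.2 ⟨hi1, hik⟩)
        change (Pi.single i s : ℕ → ℝ) n = 0
        simp [h1]
      rw [this]; exact continuous_const
  refine ⟨isInducing_iff_nhds.2 fun x => le_antisymm ?_ ?_, hinj⟩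
  · exact Filter.map_le_iff_le_comap.1 (hcont.tendsto x)
  · rw [← nhds_comap_dist x, ← Filter.tendsto_iff_comap]
    have h1 : Filter.Tendsto (fun v : ℕ → ℝ => ∑ n ∈ Finset.Icc 1 k, |v n - emb x n|)
        (𝓝 (emb x)) (𝓝 0) := by
      have : Continuous (fun v : ℕ → ℝ => ∑ n ∈ Finset.Icc 1 k, |v n - emb x n|) := by fun_prop
      simpa using this.tendsto (emb x)
    have := h1.comp (Filter.tendsto_comap (f := (emb : StarGraph k L → (ℕ → ℝ))) (x := 𝓝 (emb x)))
    refine this.congr fun y => ?_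
    simp [dist_emb]

/-- Valid parameters of a configuration. -/
def Cfg (k : ℕ) (L : ℕ → ℝ) (r : ℝ) (i : ℕ) (s : ℝ) (j : ℕ) (t : ℝ) : Prop :=
  (1 ≤ i ∧ i ≤ k ∧ 0 ≤ s ∧ s ≤ L i) ∧ (1 ≤ j ∧ j ≤ k ∧ 0 ≤ t ∧ t ≤ L j) ∧
    (i ≠ j → r ≤ s + t) ∧ (i = j → r ≤ |s - t|)

/-- Coordinates on the configuration space. -/
noncomputable def Phi {k : ℕ} {L : ℕ → ℝ} {r : ℝ} (x : ConfigSpace k L r) : (ℕ → ℝ) × (ℕ → ℝ) :=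
  (emb x.1.1, emb x.1.2)

theorem Phi_embedding {k : ℕ} {L : ℕ → ℝ} {r : ℝ} :
    IsEmbedding (Phi : ConfigSpace k L r → (ℕ → ℝ) × (ℕ → ℝ)) :=
  (emb_embedding.prodMap emb_embedding).comp IsEmbedding.subtypeVal

theorem Phi_form {k : ℕ} {L : ℕ → ℝ} {r : ℝ} (x : ConfigSpace k L r) :
    ∃ i s j t, Cfg k L r i s j t ∧ Phi x = (Pi.single i s, Pi.single j t) := by
  obtain ⟨⟨p, q⟩, h⟩ := x
  obtain ⟨p, rfl⟩ := SeparationQuotient.surjective_mk p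
  obtain ⟨q, rfl⟩ := SeparationQuotient.surjective_mk q
  refine ⟨p.1.1, p.1.2, q.1.1, q.1.2, ⟨p.2, q.2, ?_, ?_⟩, rfl⟩
  all_goals
    simp only [SeparationQuotient.dist_mk] at h
    change r ≤ starDist p q at h
    intro h'
    simpa [starDist, h'] using h

theorem Phi_surj {k : ℕ} {L : ℕ → ℝ} {r : ℝ} {i j : ℕ} {s t : ℝ} (h : Cfg k L r i s j t) :
    ∃ x : ConfigSpace k L r, Phi x = (Pi.single i s, Pi.single j t) := by
  obtain ⟨h1, h2, h3, h4⟩ := h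
  let p : StarPt k L := ⟨(i, s), h1⟩
  let q : StarPt k L := ⟨(j, t), h2⟩
  refine ⟨⟨(SeparationQuotient.mk p, SeparationQuotient.mk q), ?_⟩, rfl⟩
  simp only [SeparationQuotient.dist_mk]
  change r ≤ starDist p q
  simp only [starDist, p, q]
  split_ifs with h
  · exact h4 h
  · exact h3 h
/-- Median of the first three coordinates. -/
noncomputable def med (v : ℕ → ℝ) : ℝ := max (min (v 1) (v 2)) (min (max (v 1) (v 2)) (v 3))

/-- Spread of the first three coordinates. -/
noncomputable def spr (v : ℕ → ℝ) : ℝ := |v 1 - med v| + |v 2 - med v| + |v 3 - med v|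

/-- The scaled positive and negative parts. -/
noncomputable def GG (r : ℝ) (v : ℕ → ℝ) : (ℕ → ℝ) × (ℕ → ℝ) :=
  (fun n => if 1 ≤ n ∧ n ≤ 3 then r / spr v * max (v n - med v) 0 else 0,
   fun n => if 1 ≤ n ∧ n ≤ 3 then r / spr v * max (med v - v n) 0 else 0)

theorem GG_congr (r d : ℝ) (v w : ℕ → ℝ) (h : ∀ n, 1 ≤ n → n ≤ 3 → v n = w n + d) :
    GG r v = GG r w := by
  have hm : med v = med w + d := by
    simp only [med, h 1 (by norm_num) (by norm_num), h 2 (by norm_num) (by norm_num),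
      h 3 (by norm_num) (by norm_num), max_add_add_right, min_add_add_right]
  have hs : spr v = spr w := by
    simp only [spr, hm, h 1 (by norm_num) (by norm_num), h 2 (by norm_num) (by norm_num),
      h 3 (by norm_num) (by norm_num), add_sub_add_right_eq_sub]
  unfold GG
  refine Prod.ext ?_ ?_ <;> funext n <;> simp only <;> split_ifs with hn <;>
    first | rfl | simp [hs, hm, h n hn.1 hn.2]

theorem spr_pos (v : ℕ → ℝ) (h : ¬ (v 1 = v 3 ∧ v 2 = v 3)) : 0 < spr v := by
  by_contra hs
  have h1 := abs_nonneg (v 1 - med v)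
  have h2 := abs_nonneg (v 2 - med v)
  have h3 := abs_nonneg (v 3 - med v)
  unfold spr at hs
  have e1 : |v 1 - med v| = 0 := by linarith
  have e2 : |v 2 - med v| = 0 := by linarith
  have e3 : |v 3 - med v| = 0 := by linarith
  rw [abs_eq_zero] at e1 e2 e3
  exact h ⟨by linarith, by linarith⟩

theorem GG_cell (r : ℝ) (v : ℕ → ℝ) (i j : ℕ) (s t : ℝ) (hi : 1 ≤ i) (hi3 : i ≤ 3)
    (hj : 1 ≤ j) (hj3 : j ≤ 3) (hij : i ≠ j) (hs : 0 ≤ s) (ht : 0 ≤ t) (d : ℝ)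
    (hv : ∀ n, 1 ≤ n → n ≤ 3 →
      v n = (Pi.single i s : ℕ → ℝ) n - (Pi.single j t : ℕ → ℝ) n + d) :
    GG r v = (Pi.single i (r / (s + t) * s), Pi.single j (r / (s + t) * t)) := by
  set w : ℕ → ℝ := fun n => (Pi.single i s : ℕ → ℝ) n - (Pi.single j t : ℕ → ℝ) n with hw
  rw [GG_congr r d v w hv]
  have hm : med w = 0 ∧ spr w = s + t := by
    have hm : med w = 0 := by
      interval_cases i <;> interval_cases j <;> first | exact absurd rfl hij | skip
      all_goals simp [med, hw, hs, ht]
    refine ⟨hm, ?_⟩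
    rw [spr, hm]
    interval_cases i <;> interval_cases j <;> first | exact absurd rfl hij | skip
    all_goals simp [hw, abs_of_nonneg, hs, ht]
    all_goals ring
  unfold GG
  rw [hm.1, hm.2]
  refine Prod.ext ?_ ?_ <;> funext n <;> simp only [hw, Pi.single_apply] <;> split_ifs <;>
    first | omega | simp [hs, ht]

theorem exists_sorted (v : ℕ → ℝ) : ∃ i j l, 1 ≤ i ∧ i ≤ 3 ∧ 1 ≤ j ∧ j ≤ 3 ∧ 1 ≤ l ∧ l ≤ 3 ∧
    i ≠ j ∧ i ≠ l ∧ j ≠ l ∧ v l ≤ v i ∧ v j ≤ v l := by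
  rcases le_total (v 1) (v 2) with h1 | h1 <;> rcases le_total (v 1) (v 3) with h2 | h2 <;>
    rcases le_total (v 2) (v 3) with h3 | h3
  · exact ⟨3, 1, 2, by simp [*]⟩
  · exact ⟨2, 1, 3, by simp [*]⟩
  · exact ⟨3, 1, 2, by simp [*]⟩
  · exact ⟨2, 3, 1, by simp [*]⟩
  · exact ⟨3, 2, 1, by simp [*]⟩
  · exact ⟨1, 3, 2, by simp [*]⟩
  · exact ⟨1, 2, 3, by simp [*]⟩
  · exact ⟨1, 3, 2, by simp [*]⟩

theorem GG_form (r : ℝ) (hr : 0 < r) (v : ℕ → ℝ) (h : ¬ (v 1 = v 3 ∧ v 2 = v 3)) :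
    ∃ i j s t, 1 ≤ i ∧ i ≤ 3 ∧ 1 ≤ j ∧ j ≤ 3 ∧ i ≠ j ∧ 0 ≤ s ∧ 0 ≤ t ∧ s + t = r ∧
      GG r v = (Pi.single i s, Pi.single j t) := by
  obtain ⟨i, j, l, hi, hi3, hj, hj3, hl, hl3, hij, hil, hjl, h1, h2⟩ := exists_sorted v
  have hpos : 0 < (v i - v l) + (v l - v j) := by
    by_contra hc
    apply h
    have e1 : v i = v l := by linarith
    have e2 : v j = v l := by linarith
    have key : ∀ n, 1 ≤ n → n ≤ 3 → v n = v l := by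
      intro n hn hn3
      have : n = i ∨ n = j ∨ n = l := by omega
      rcases this with rfl | rfl | rfl
      exacts [e1, e2, rfl]
    simp [key]
  refine ⟨i, j, _, _, hi, hi3, hj, hj3, hij, ?_, ?_, ?_,
    GG_cell r v i j (v i - v l) (v l - v j) hi hi3 hj hj3 hij (by linarith) (by linarith) (v l) ?_⟩
  · have : 0 ≤ v i - v l := by linarith
    positivity
  · have : 0 ≤ v l - v j := by linarith
    positivity
  · field_simp
  · intro n hn hn3
    have : n = i ∨ n = j ∨ n = l := by omega
    rcases this with rfl | rfl | rfl
    · simp [hij]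
    · simp [hij.symm]
    · simp [hil.symm, hjl.symm]

theorem GG_diff (r : ℝ) (v : ℕ → ℝ) (n : ℕ) (hn : 1 ≤ n) (hn3 : n ≤ 3) :
    (GG r v).1 n - (GG r v).2 n = r / spr v * (v n - med v) := by
  simp only [GG, if_pos (And.intro hn hn3)]
  rw [← mul_sub]
  congr 1
  rcases le_total (v n) (med v) with h | h
  · rw [max_eq_right (by linarith), max_eq_left (by linarith)]; ring
  · rw [max_eq_left (by linarith), max_eq_right (by linarith)]; ring

theorem nonconst_cell (v : ℕ → ℝ) (i j : ℕ) (s t : ℝ) (hi : 1 ≤ i) (hi3 : i ≤ 3)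
    (hj : 1 ≤ j) (hj3 : j ≤ 3) (hij : i ≠ j) (hst : 0 < s + t) (d : ℝ)
    (hv : ∀ n, 1 ≤ n → n ≤ 3 →
      v n = (Pi.single i s : ℕ → ℝ) n - (Pi.single j t : ℕ → ℝ) n + d) :
    ¬ (v 1 = v 3 ∧ v 2 = v 3) := by
  rintro ⟨h1, h2⟩
  have key : ∀ n, 1 ≤ n → n ≤ 3 → v n = v 3 := by
    intro n hn hn3
    interval_cases n
    exacts [h1, h2, rfl]
  have e1 := hv i hi hi3
  have e2 := hv j hj hj3
  rw [key i hi hi3] at e1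
  rw [key j hj hj3] at e2
  simp [hij] at e1
  simp [hij.symm] at e2
  linarith

theorem GG_plus (r : ℝ) (v : ℕ → ℝ) (i : ℕ) (a : ℝ) (hi : 1 ≤ i) (hi3 : i ≤ 3)
    (ha : 0 < a) (d : ℝ)
    (hv : ∀ n, 1 ≤ n → n ≤ 3 → v n = (Pi.single i a : ℕ → ℝ) n + d) (j : ℕ) :
    ¬ (v 1 = v 3 ∧ v 2 = v 3) ∧ GG r v = (Pi.single i r, Pi.single j 0) := by
  obtain ⟨j', hj', hj'3, hij⟩ : ∃ j', 1 ≤ j' ∧ j' ≤ 3 ∧ i ≠ j' := by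
    by_cases h : i = 1
    · exact ⟨2, by omega⟩
    · exact ⟨1, by omega⟩
  have hv' : ∀ n, 1 ≤ n → n ≤ 3 →
      v n = (Pi.single i a : ℕ → ℝ) n - (Pi.single j' 0 : ℕ → ℝ) n + d := by
    intro n h1 h2; simp [hv n h1 h2]
  refine ⟨nonconst_cell v i j' a 0 hi hi3 hj' hj'3 hij (by linarith) d hv', ?_⟩
  rw [GG_cell r v i j' a 0 hi hi3 hj' hj'3 hij ha.le le_rfl d hv']
  have : r / (a + 0) * a = r := by field_simp; simp
  rw [this]; simp

theorem GG_minus (r : ℝ) (v : ℕ → ℝ) (j : ℕ) (a : ℝ) (hj : 1 ≤ j) (hj3 : j ≤ 3)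
    (ha : 0 < a) (d : ℝ)
    (hv : ∀ n, 1 ≤ n → n ≤ 3 → v n = - (Pi.single j a : ℕ → ℝ) n + d) (i : ℕ) :
    ¬ (v 1 = v 3 ∧ v 2 = v 3) ∧ GG r v = (Pi.single i 0, Pi.single j r) := by
  obtain ⟨i', hi', hi'3, hij⟩ : ∃ i', 1 ≤ i' ∧ i' ≤ 3 ∧ i' ≠ j := by
    by_cases h : j = 1
    · exact ⟨2, by omega⟩
    · exact ⟨1, by omega⟩
  have hv' : ∀ n, 1 ≤ n → n ≤ 3 →
      v n = (Pi.single i' 0 : ℕ → ℝ) n - (Pi.single j a : ℕ → ℝ) n + d := by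
    intro n h1 h2; simp [hv n h1 h2]
  refine ⟨nonconst_cell v i' j 0 a hi' hi'3 hj hj3 hij (by linarith) d hv', ?_⟩
  rw [GG_cell r v i' j 0 a hi' hi'3 hj hj3 hij le_rfl ha.le d hv']
  have : r / (0 + a) * a = r := by field_simp; simp
  rw [this]; simp

/-- Computation of the retraction on each cell of the main component. -/
theorem GG_on_main (k : ℕ) (r : ℝ) (hr : 0 < r) (L : ℕ → ℝ)
    (hbig : ∀ i, 1 ≤ i → i ≤ 3 → r ≤ L i) (hsmall : ∀ i, 4 ≤ i → i ≤ k → L i < r)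
    (i j : ℕ) (s t : ℝ) (h : Cfg k L r i s j t) (h3 : i ≤ 3 ∨ j ≤ 3)
    (v : ℕ → ℝ) (d : ℝ) (hv : ∀ n, 1 ≤ n → n ≤ 3 →
      v n = (Pi.single i s : ℕ → ℝ) n - (Pi.single j t : ℕ → ℝ) n + d) :
    ¬ (v 1 = v 3 ∧ v 2 = v 3) ∧
    ∃ s' t', GG r v = (Pi.single i s', Pi.single j t') ∧ Cfg k L r i s' j t' ∧
      (i = j → (s - t) * (s' - t') ≥ 0) := by
  obtain ⟨⟨hi, hik, hs, hsL⟩, ⟨hj, hjk, ht, htL⟩, hne, heq⟩ := h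
  by_cases hij : i = j
  · subst hij
    have hi3 : i ≤ 3 := by omega
    have hb := hbig i hi hi3
    rcases le_abs.1 (heq rfl) with h | h
    · obtain ⟨h1, h2⟩ := GG_plus r v i (s - t) hi hi3 (by linarith) d
        (fun n a b => by rw [hv n a b, Pi.single_sub, Pi.sub_apply]) i
      refine ⟨h1, _, _, h2, ⟨⟨hi, hik, hr.le, hb⟩, ⟨hi, hik, le_rfl, by linarith⟩,
        fun h => absurd rfl h, fun _ => ?_⟩, fun _ => ?_⟩
      · simp [abs_of_pos hr]
      · have : 0 ≤ s - t := by linarith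
        simp only [sub_zero, ge_iff_le]; positivity
    · obtain ⟨h1, h2⟩ := GG_minus r v i (t - s) hi hi3 (by linarith) d
        (fun n a b => by rw [hv n a b, Pi.single_sub, Pi.sub_apply]; ring) i
      refine ⟨h1, _, _, h2, ⟨⟨hi, hik, le_rfl, by linarith⟩, ⟨hi, hik, hr.le, hb⟩,
        fun h => absurd rfl h, fun _ => ?_⟩, fun _ => ?_⟩
      · simp [abs_of_pos hr]
      · nlinarith
  · have hst := hne hij
    by_cases hi3 : i ≤ 3
    · by_cases hj3 : j ≤ 3
      · have hpos : 0 < s + t := by linarith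
        refine ⟨nonconst_cell v i j s t hi hi3 hj hj3 hij hpos d hv, _, _,
          GG_cell r v i j s t hi hi3 hj hj3 hij hs ht d hv, ?_, fun h => absurd h hij⟩
        have e : r / (s + t) * s + r / (s + t) * t = r := by field_simp
        have e1 : 0 ≤ r / (s + t) * s := by positivity
        have e2 : 0 ≤ r / (s + t) * t := by positivity
        have := hbig i hi hi3
        have := hbig j hj hj3
        exact ⟨⟨hi, hik, e1, by linarith⟩, ⟨hj, hjk, e2, by linarith⟩, fun _ => e.ge,
          fun h => absurd h hij⟩
      · have := hsmall j (by omega) hjk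
        obtain ⟨h1, h2⟩ := GG_plus r v i s hi hi3 (by linarith) d
          (fun n a b => by
            have : n ≠ j := by omega
            rw [hv n a b]; simp [this]) j
        exact ⟨h1, _, _, h2, ⟨⟨hi, hik, hr.le, hbig i hi hi3⟩, ⟨hj, hjk, le_rfl, by linarith⟩,
          fun _ => by simp, fun h => absurd h hij⟩, fun h => absurd h hij⟩
    · have hj3 : j ≤ 3 := by omega
      have := hsmall i (by omega) hik
      obtain ⟨h1, h2⟩ := GG_minus r v j t hj hj3 (by linarith) d
        (fun n a b => by
          have : n ≠ i := by omega
          rw [hv n a b]; simp [this]) i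
      exact ⟨h1, _, _, h2, ⟨⟨hi, hik, le_rfl, by linarith⟩, ⟨hj, hjk, hr.le, hbig j hj hj3⟩,
        fun _ => by simp, fun h => absurd h hij⟩, fun h => absurd h hij⟩
theorem Cfg_convex {k : ℕ} {L : ℕ → ℝ} {r : ℝ} (hr : 0 < r) {i j : ℕ} {s t s' t' : ℝ}
    (h : Cfg k L r i s j t) (h' : Cfg k L r i s' j t') (hsgn : i = j → (s - t) * (s' - t') ≥ 0)
    {a b : ℝ} (ha : 0 ≤ a) (hb : 0 ≤ b) (hab : a + b = 1) :
    Cfg k L r i (a * s' + b * s) j (a * t' + b * t) := by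
  obtain ⟨⟨hi, hik, hs, hsL⟩, ⟨hj, hjk, ht, htL⟩, hne, heq⟩ := h
  obtain ⟨⟨_, _, hs', hsL'⟩, ⟨_, _, ht', htL'⟩, hne', heq'⟩ := h'
  have conv : ∀ c x y : ℝ, x ≤ c → y ≤ c → a * x + b * y ≤ c := by
    intro c x y hx hy
    have := mul_le_mul_of_nonneg_left hx ha
    have := mul_le_mul_of_nonneg_left hy hb
    calc a * x + b * y ≤ a * c + b * c := by linarith
      _ = c := by rw [← add_mul, hab, one_mul]
  have conv' : ∀ c x y : ℝ, c ≤ x → c ≤ y → c ≤ a * x + b * y := by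
    intro c x y hx hy
    have := conv (-c) (-x) (-y) (by linarith) (by linarith)
    linarith
  refine ⟨⟨hi, hik, by positivity, conv _ _ _ hsL' hsL⟩,
    ⟨hj, hjk, by positivity, conv _ _ _ htL' htL⟩, fun h => ?_, fun h => ?_⟩
  · have := conv' _ _ _ (hne' h) (hne h)
    linarith
  · have hsg := hsgn h
    rcases le_abs.1 (heq h) with h1 | h1 <;> rcases le_abs.1 (heq' h) with h2 | h2
    · have := conv' _ _ _ h2 h1
      exact le_abs.2 (Or.inl (by linarith))
    · nlinarith
    · nlinarith
    · have := conv' _ _ _ h2 h1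
      exact le_abs.2 (Or.inr (by linarith))

/-- The main component in coordinates. -/
def Bmain (k : ℕ) (L : ℕ → ℝ) (r : ℝ) : Set ((ℕ → ℝ) × (ℕ → ℝ)) :=
  {e | ∃ i s j t, Cfg k L r i s j t ∧ (i ≤ 3 ∨ j ≤ 3) ∧ e = (Pi.single i s, Pi.single j t)}

/-- A small cell in coordinates. -/
def Bcell (k : ℕ) (L : ℕ → ℝ) (r : ℝ) (i j : ℕ) : Set ((ℕ → ℝ) × (ℕ → ℝ)) :=
  {e | ∃ s t, Cfg k L r i s j t ∧ e = (Pi.single i s, Pi.single j t)}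

theorem comb_single (i j : ℕ) (a b s t s' t' : ℝ) :
    a • ((Pi.single i s', Pi.single j t') : (ℕ → ℝ) × (ℕ → ℝ)) + b • (Pi.single i s, Pi.single j t)
      = (Pi.single i (a * s' + b * s), Pi.single j (a * t' + b * t)) := by
  refine Prod.ext ?_ ?_ <;> funext n <;> simp [Pi.single_apply] <;> split_ifs <;> simp

theorem Bcell_convex {k : ℕ} {L : ℕ → ℝ} {r : ℝ} (hr : 0 < r) {i j : ℕ} (hij : i ≠ j) :
    Convex ℝ (Bcell k L r i j) := by
  rintro _ ⟨s', t', h', rfl⟩ _ ⟨s, t, h, rfl⟩ a b ha hb hab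
  exact ⟨_, _, Cfg_convex hr h h' (fun h => absurd h hij) ha hb hab, comb_single _ _ _ _ _ _ _ _⟩

/-- The difference vector of a configuration, as a complex number. -/
noncomputable def zof (e : (ℕ → ℝ) × (ℕ → ℝ)) : ℂ :=
  (((e.1 1 - e.2 1) - (e.1 3 - e.2 3) : ℝ) : ℂ) +
    (((e.1 2 - e.2 2) - (e.1 3 - e.2 3) : ℝ) : ℂ) * Complex.I

/-- The vector of a complex number. -/
noncomputable def vof (z : ℂ) : ℕ → ℝ := fun n => if n = 1 then z.re else if n = 2 then z.im else 0

theorem vof_nonconst (z : ℂ) : ¬ (vof z 1 = vof z 3 ∧ vof z 2 = vof z 3) ↔ z ≠ 0 := by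
  simp [vof, Complex.ext_iff]

theorem vof_zof (e : (ℕ → ℝ) × (ℕ → ℝ)) (n : ℕ) (hn : 1 ≤ n) (hn3 : n ≤ 3) :
    vof (zof e) n = e.1 n - e.2 n + -(e.1 3 - e.2 3) := by
  interval_cases n <;> simp [vof, zof] <;> ring

theorem zof_GG (r : ℝ) (z : ℂ) : zof (GG r (vof z)) = ((r / spr (vof z) : ℝ) : ℂ) * z := by
  unfold zof
  rw [GG_diff _ _ 1 (by norm_num) (by norm_num), GG_diff _ _ 2 (by norm_num) (by norm_num),
    GG_diff _ _ 3 (by norm_num) (by norm_num)]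
  apply Complex.ext <;> simp [vof] <;> ring

theorem vof_cont : Continuous vof := by
  refine continuous_pi fun n => ?_
  unfold vof
  split_ifs <;> fun_prop

theorem med_cont : Continuous med := by unfold med; fun_prop

theorem spr_cont : Continuous spr := by
  have := med_cont
  unfold spr; fun_prop

theorem scale_cont (r : ℝ) : Continuous fun z : {z : ℂ // z ≠ 0} => r / spr (vof z) :=
  continuous_const.div (spr_cont.comp (vof_cont.comp continuous_subtype_val))
    fun z => (spr_pos _ ((vof_nonconst _).2 z.2)).ne'

theorem GG_cont (r : ℝ) : Continuous fun z : {z : ℂ // z ≠ 0} => GG r (vof z) := by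
  have h1 := scale_cont r
  have h2 : Continuous fun z : {z : ℂ // z ≠ 0} => vof z := vof_cont.comp continuous_subtype_val
  have h3 : Continuous fun z : {z : ℂ // z ≠ 0} => med (vof z) := med_cont.comp h2
  have h4 : ∀ n, Continuous fun z : {z : ℂ // z ≠ 0} => vof z n :=
    fun n => (continuous_apply n).comp h2
  unfold GG
  refine Continuous.prodMk (continuous_pi fun n => ?_) (continuous_pi fun n => ?_)
  · have := h4 n
    split_ifs
    · exact h1.mul ((this.sub h3).max continuous_const)
    · fun_prop
  · have := h4 n
    split_ifs
    · exact h1.mul ((h3.sub this).max continuous_const)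
    · fun_prop

theorem zof_cont : Continuous zof := by unfold zof; fun_prop

section main
open ContinuousMap

theorem main_hequiv (k : ℕ) (hk : 3 ≤ k) (r : ℝ) (hr : 0 < r) (L : ℕ → ℝ)
    (hbig : ∀ i, 1 ≤ i → i ≤ 3 → r ≤ L i) (hsmall : ∀ i, 4 ≤ i → i ≤ k → L i < r) :
    Nonempty (Bmain k L r ≃ₕ {z : ℂ // z ≠ 0}) := by
  have hz : ∀ e ∈ Bmain k L r, zof e ≠ 0 := by
    rintro _ ⟨i, s, j, t, h, h3, rfl⟩
    have := (GG_on_main k r hr L hbig hsmall i j s t h h3 _ _ (vof_zof (Pi.single i s, Pi.single j t))).1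
    exact (vof_nonconst _).1 this
  have hG : ∀ z : ℂ, z ≠ 0 → GG r (vof z) ∈ Bmain k L r := by
    intro z hz
    obtain ⟨i, j, s, t, hi, hi3, hj, hj3, hij, hs, ht, hst, h⟩ :=
      GG_form r hr (vof z) ((vof_nonconst z).2 hz)
    have := hbig i hi hi3
    have := hbig j hj hj3
    exact ⟨i, s, j, t, ⟨⟨hi, by omega, hs, by linarith⟩, ⟨hj, by omega, ht, by linarith⟩,
      fun _ => hst.ge, fun h => absurd h hij⟩, Or.inl hi3, h⟩
  have hH : ∀ e ∈ Bmain k L r, ∀ u : unitInterval,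
      (1 - (u : ℝ)) • GG r (vof (zof e)) + (u : ℝ) • e ∈ Bmain k L r := by
    rintro _ ⟨i, s, j, t, h, h3, rfl⟩ u
    obtain ⟨s', t', hGG, h', hsgn⟩ :=
      (GG_on_main k r hr L hbig hsmall i j s t h h3 _ _ (vof_zof (Pi.single i s, Pi.single j t))).2
    rw [hGG, comb_single]
    exact ⟨i, _, j, _, Cfg_convex hr h h' hsgn (sub_nonneg.2 u.2.2) u.2.1 (by ring), h3, rfl⟩
  have hK : ∀ z : ℂ, z ≠ 0 → ∀ u : unitInterval,
      (((1 - (u : ℝ)) * (r / spr (vof z)) + (u : ℝ) : ℝ) : ℂ) * z ≠ 0 := by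
    intro z hz u
    have hp := spr_pos _ ((vof_nonconst _).2 hz)
    refine mul_ne_zero ?_ hz
    rw [Ne, Complex.ofReal_eq_zero]
    have h0 : 0 < r / spr (vof z) := by positivity
    have h1 := u.2.1
    have h2 := u.2.2
    rcases h1.lt_or_eq with h | h
    · have : 0 ≤ (1 - (u : ℝ)) * (r / spr (vof z)) := mul_nonneg (by linarith) h0.le
      linarith
    · rw [← h]; simpa using ⟨hr.ne', hp.ne'⟩
  let f : C(Bmain k L r, {z : ℂ // z ≠ 0}) :=
    ⟨fun e => ⟨zof e, hz e e.2⟩, (zof_cont.comp continuous_subtype_val).subtype_mk _⟩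
  let g : C({z : ℂ // z ≠ 0}, Bmain k L r) :=
    ⟨fun z => ⟨GG r (vof z), hG z z.2⟩, (GG_cont r).subtype_mk _⟩
  refine ⟨⟨f, g, ⟨⟨⟨fun p => ⟨_, hH p.2 p.2.2 p.1⟩, ?_⟩, ?_, ?_⟩⟩,
    ⟨⟨⟨fun p => ⟨_, hK p.2 p.2.2 p.1⟩, ?_⟩, ?_, ?_⟩⟩⟩⟩
  · refine Continuous.subtype_mk ?_ _
    have h1 : Continuous fun p : unitInterval × Bmain k L r => GG r (vof (zof p.2)) :=
      (GG_cont r).comp (f.continuous.comp continuous_snd)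
    fun_prop
  · intro e
    apply Subtype.ext
    simp [f, g]
  · intro e
    apply Subtype.ext
    simp
  · refine Continuous.subtype_mk ?_ _
    have h1 : Continuous fun p : unitInterval × {z : ℂ // z ≠ 0} => r / spr (vof p.2) :=
      (scale_cont r).comp continuous_snd
    fun_prop
  · intro z
    apply Subtype.ext
    simp [f, g, zof_GG]
  · intro z
    apply Subtype.ext
    simp

end main
theorem count_pairs (k : ℕ) (hk : 4 ≤ k) (r : ℝ) (L : ℕ → ℝ)
    (hLpos : ∀ i, 1 ≤ i → i ≤ k → 0 < L i) (hbig : ∀ i, 1 ≤ i → i ≤ 3 → r ≤ L i) :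
    (Nat.card {p : ℕ × ℕ // 4 ≤ p.1 ∧ p.1 ≤ k ∧ 4 ≤ p.2 ∧ p.2 ≤ k ∧ p.1 ≠ p.2 ∧
      r ≤ L p.1 + L p.2} : ℤ) = ((k : ℤ) - 3) * ((k : ℤ) - 4) - 2 * (pairCount k r L : ℤ) := by
  classical
  set T := (Finset.Icc 4 k).offDiag with hT
  set F := T.filter (fun p => r ≤ L p.1 + L p.2) with hF
  set F1 := (T.filter (fun p => ¬ r ≤ L p.1 + L p.2)).filter (fun p => p.1 < p.2) with hF1
  set F2 := (T.filter (fun p => ¬ r ≤ L p.1 + L p.2)).filter (fun p => ¬ p.1 < p.2) with hF2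
  have c1 : Nat.card {p : ℕ × ℕ // 4 ≤ p.1 ∧ p.1 ≤ k ∧ 4 ≤ p.2 ∧ p.2 ≤ k ∧ p.1 ≠ p.2 ∧
      r ≤ L p.1 + L p.2} = F.card := by
    refine Nat.subtype_card F ?_
    rintro ⟨a, b⟩
    simp only [hF, hT, Finset.mem_filter, Finset.mem_offDiag, Finset.mem_Icc]
    tauto
  have c2 : F.card + (F1.card + F2.card) = T.card := by
    rw [hF1, hF2, Finset.card_filter_add_card_filter_not, hF,
      Finset.card_filter_add_card_filter_not]
  have c3 : F2.card = F1.card := by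
    refine Finset.card_bij (fun p _ => p.swap) ?_ ?_ ?_
    · rintro ⟨a, b⟩ h
      simp only [hF1, hF2, hT, Finset.mem_filter, Finset.mem_offDiag, Finset.mem_Icc,
        Prod.swap] at h ⊢
      obtain ⟨⟨⟨h1, h2, h3⟩, h4⟩, h5⟩ := h
      exact ⟨⟨⟨h2, h1, h3.symm⟩, by rwa [add_comm]⟩, by omega⟩
    · rintro ⟨a, b⟩ _ ⟨c, d⟩ _ h
      simpa [Prod.swap, and_comm] using h
    · rintro ⟨a, b⟩ h
      refine ⟨(b, a), ?_, rfl⟩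
      simp only [hF1, hF2, hT, Finset.mem_filter, Finset.mem_offDiag, Finset.mem_Icc] at h ⊢
      obtain ⟨⟨⟨h1, h2, h3⟩, h4⟩, h5⟩ := h
      exact ⟨⟨⟨h2, h1, h3.symm⟩, by rwa [add_comm]⟩, by omega⟩
  have c4 : pairCount k r L = F1.card := by
    rw [pairCount, ← Set.ncard_coe_finset]
    congr 1
    ext ⟨a, b⟩
    simp only [hF1, hT, Set.mem_setOf_eq, Finset.coe_filter, Finset.mem_filter,
      Finset.mem_offDiag, Finset.mem_Icc, not_le]
    constructor
    · rintro ⟨h1, h2, h3, h4⟩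
      have : 4 ≤ a := by
        by_contra hc
        have := hbig a h1 (by omega)
        have := hLpos b (by omega) h3
        linarith
      exact ⟨⟨⟨⟨by omega, by omega⟩, ⟨by omega, by omega⟩, by omega⟩, h4⟩, h2⟩
    · rintro ⟨⟨⟨h1, h2, h3⟩, h4⟩, h5⟩
      exact ⟨by omega, h5, h2.2, h4⟩
  have c5 : (T.card : ℤ) = ((k : ℤ) - 3) * ((k : ℤ) - 4) := by
    obtain ⟨m, rfl⟩ := Nat.exists_eq_add_of_le hk
    rw [hT, Finset.offDiag_card, Nat.card_Icc]
    have : 4 + m + 1 - 4 = m + 1 := by omega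
    rw [this, Nat.cast_sub (Nat.le_mul_self _)]
    push_cast; ring
  rw [c1, c4, ← c5, ← c2, c3]
  push_cast; ring

/-- The index type of the components. -/
abbrev CompIdx (k : ℕ) (L : ℕ → ℝ) (r : ℝ) : Type :=
  Option {p : ℕ × ℕ // 4 ≤ p.1 ∧ p.1 ≤ k ∧ 4 ≤ p.2 ∧ p.2 ≤ k ∧ p.1 ≠ p.2 ∧ r ≤ L p.1 + L p.2}

/-- The components in coordinates. -/
def Bset (k : ℕ) (L : ℕ → ℝ) (r : ℝ) : CompIdx k L r → Set ((ℕ → ℝ) × (ℕ → ℝ))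
  | none => Bmain k L r
  | some p => Bcell k L r p.1.1 p.1.2

theorem Bset_range {k : ℕ} {L : ℕ → ℝ} {r : ℝ} (o : CompIdx k L r) :
    Bset k L r o ⊆ Set.range (Phi : ConfigSpace k L r → _) := by
  cases o with
  | none => rintro _ ⟨i, s, j, t, h, _, rfl⟩; exact Phi_surj h
  | some p => rintro _ ⟨s, t, h, rfl⟩; exact Phi_surj h

theorem single_ne {i n : ℕ} {s : ℝ} (h : (Pi.single i s : ℕ → ℝ) n ≠ 0) : n = i ∧ s ≠ 0 := by
  by_cases hn : n = i
  · subst hn; simpa using h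
  · simp [hn] at h

theorem mem_main_iff {k : ℕ} {L : ℕ → ℝ} {r : ℝ} (hr : 0 < r)
    (hsmall : ∀ i, 4 ≤ i → i ≤ k → L i < r) (x : ConfigSpace k L r) :
    Phi x ∈ Bmain k L r ↔ ∃ n, (1 ≤ n ∧ n ≤ 3) ∧ ((Phi x).1 n ≠ 0 ∨ (Phi x).2 n ≠ 0) := by
  constructor
  · rintro ⟨i, s, j, t, ⟨⟨hi, hik, hs, hsL⟩, ⟨hj, hjk, ht, htL⟩, hne, heq⟩, h3, h⟩
    rw [h]
    by_cases h1 : i ≤ 3 ∧ s ≠ 0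
    · exact ⟨i, ⟨hi, h1.1⟩, Or.inl (by simpa using h1.2)⟩
    by_cases h2 : j ≤ 3 ∧ t ≠ 0
    · exact ⟨j, ⟨hj, h2.1⟩, Or.inr (by simpa using h2.2)⟩
    exfalso
    rw [not_and_not_right] at h1 h2
    by_cases hij : i = j
    · subst hij
      have hi3 : i ≤ 3 := by omega
      have := heq rfl
      rw [h1 hi3, h2 hi3] at this
      simp at this
      linarith
    · have hst := hne hij
      by_cases hi3 : i ≤ 3
      · have := h1 hi3
        by_cases hj3 : j ≤ 3
        · have := h2 hj3
          linarith
        · have := hsmall j (by omega) hjk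
          linarith
      · have := h2 (by omega)
        have := hsmall i (by omega) hik
        linarith
  · rintro ⟨n, hn, h⟩
    obtain ⟨i, s, j, t, hc, hx⟩ := Phi_form x
    rw [hx] at h ⊢
    refine ⟨i, s, j, t, hc, ?_, rfl⟩
    rcases h with h | h
    · left; rw [← (single_ne h).1]; exact hn.2
    · right; rw [← (single_ne h).1]; exact hn.2

theorem mem_cell_iff {k : ℕ} {L : ℕ → ℝ} {r : ℝ} 
    (hsmall : ∀ i, 4 ≤ i → i ≤ k → L i < r) (x : ConfigSpace k L r) {i j : ℕ} (hij : i ≠ j)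
    (hi : 4 ≤ i) (hik : i ≤ k) (hj : 4 ≤ j) (hjk : j ≤ k) :
    Phi x ∈ Bcell k L r i j ↔ (Phi x).1 i ≠ 0 ∧ (Phi x).2 j ≠ 0 := by
  constructor
  · rintro ⟨s, t, ⟨⟨_, _, hs, hsL⟩, ⟨_, _, ht, htL⟩, hne, heq⟩, h⟩
    rw [h]
    have := hne hij
    have := hsmall i hi hik
    have := hsmall j hj hjk
    constructor
    · intro h; simp at h; linarith
    · intro h; simp at h; linarith
  · rintro ⟨h1, h2⟩
    obtain ⟨i', s, j', t, hc, hx⟩ := Phi_form x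
    rw [hx] at h1 h2 ⊢
    obtain ⟨rfl, _⟩ := single_ne h1
    obtain ⟨rfl, _⟩ := single_ne h2
    exact ⟨s, t, hc, rfl⟩

theorem configSpace_components_and_pi1 (k : ℕ) (hk : 4 ≤ k) (r : ℝ) (hr : 0 < r)
    (L : ℕ → ℝ) (hLpos : ∀ i, 1 ≤ i → i ≤ k → 0 < L i)
    (hmono : ∀ i j, 2 ≤ i → i ≤ j → j ≤ k → L j ≤ L i)
    (hL4 : L 4 < r) (hL3 : r ≤ L 3) (hL1 : r ≤ L 1) :
    (Nat.card (ZerothHomotopy (ConfigSpace k L r)) : ℤ)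
        = ((k : ℤ) - 3) * ((k : ℤ) - 4) + 1 - 2 * (pairCount k r L : ℤ) ∧
    ∃ x : ConfigSpace k L r,
      ¬ SimplyConnectedSpace (pathComponent x) ∧
      (∀ y : ConfigSpace k L r, ¬ SimplyConnectedSpace (pathComponent y) →
        pathComponent y = pathComponent x) ∧
      ∀ y : pathComponent x,
        Nonempty (FundamentalGroup (pathComponent x) y ≃* Multiplicative ℤ) := by
  have hbig : ∀ i, 1 ≤ i → i ≤ 3 → r ≤ L i := by
    intro i h1 h3
    by_cases hi : i = 1
    · rw [hi]; exact hL1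
    · exact hL3.trans (hmono i 3 (by omega) h3 (by omega))
  have hsmall : ∀ i, 4 ≤ i → i ≤ k → L i < r := fun i h4 hik =>
    (hmono 4 i (by omega) h4 hik).trans_lt hL4
  let A : CompIdx k L r → Set (ConfigSpace k L r) := fun o => Phi ⁻¹' Bset k L r o
  have hom : ∀ o, Nonempty (A o ≃ₜ Bset k L r o) := fun o =>
    ⟨Phi_embedding.homeomorphOfSubsetRange (Bset_range o)⟩
  have hmem_none : ∀ x, x ∈ A none ↔
      ∃ n, (1 ≤ n ∧ n ≤ 3) ∧ ((Phi x).1 n ≠ 0 ∨ (Phi x).2 n ≠ 0) :=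
    fun x => mem_main_iff hr hsmall x
  have hmem_some : ∀ p x, x ∈ A (some p) ↔ (Phi x).1 p.1.1 ≠ 0 ∧ (Phi x).2 p.1.2 ≠ 0 :=
    fun p x => mem_cell_iff hsmall x p.2.2.2.2.2.1 p.2.1 p.2.2.1 p.2.2.2.1 p.2.2.2.2.1
  have hc1 : ∀ n, Continuous fun x : ConfigSpace k L r => (Phi x).1 n := fun n =>
    (continuous_apply n).comp (continuous_fst.comp Phi_embedding.continuous)
  have hc2 : ∀ n, Continuous fun x : ConfigSpace k L r => (Phi x).2 n := fun n =>
    (continuous_apply n).comp (continuous_snd.comp Phi_embedding.continuous)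
  have hopen : ∀ o, IsOpen (A o) := by
    intro o
    cases o with
    | none =>
      have : A none = ⋃ n, ⋃ (_ : 1 ≤ n ∧ n ≤ 3),
          ({x | (Phi x).1 n ≠ 0} ∪ {x | (Phi x).2 n ≠ 0}) := by
        ext x
        rw [hmem_none]
        simp only [Set.mem_iUnion, Set.mem_union, Set.mem_setOf_eq, exists_prop]
      rw [this]
      exact isOpen_iUnion fun n => isOpen_iUnion fun _ =>
        (isOpen_ne_fun (hc1 n) continuous_const).union (isOpen_ne_fun (hc2 n) continuous_const)
    | some p =>
      have : A (some p) = {x | (Phi x).1 p.1.1 ≠ 0} ∩ {x | (Phi x).2 p.1.2 ≠ 0} := by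
        ext x
        rw [hmem_some]
        rfl
      rw [this]
      exact (isOpen_ne_fun (hc1 _) continuous_const).inter (isOpen_ne_fun (hc2 _) continuous_const)
  have hcov : ∀ x, ∃ o, x ∈ A o := by
    intro x
    obtain ⟨i, s, j, t, hc, hx⟩ := Phi_form x
    by_cases h3 : i ≤ 3 ∨ j ≤ 3
    · exact ⟨none, i, s, j, t, hc, h3, hx⟩
    · push Not at h3
      have hc' := hc
      obtain ⟨⟨_, hik, hs, hsL⟩, ⟨_, hjk, ht, htL⟩, hne, heq⟩ := hc'
      have hi := hsmall i (by omega) hik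
      have hj := hsmall j (by omega) hjk
      have hij : i ≠ j := by
        intro h
        rcases le_abs.1 (heq h) with h | h <;> linarith
      have := hne hij
      exact ⟨some ⟨(i, j), by omega, hik, by omega, hjk, hij, by simp only; linarith⟩,
        s, t, hc, hx⟩
  have hdis0 : ∀ p x, x ∈ A none → x ∈ A (some p) → False := by
    intro p x h1 h2
    obtain ⟨n, hn, h⟩ := (hmem_none x).1 h1
    obtain ⟨s, t, hc, hx⟩ := h2
    rw [hx] at h
    have := p.2.1
    have := p.2.2.2.1
    rcases h with h | h
    · have := (single_ne h).1
      omega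
    · have := (single_ne h).1
      omega
  have hdis : ∀ o o' x, x ∈ A o → x ∈ A o' → o = o' := by
    intro o o' x h h'
    cases o with
    | none =>
      cases o' with
      | none => rfl
      | some p => exact (hdis0 p x h h').elim
    | some p =>
      cases o' with
      | none => exact (hdis0 p x h' h).elim
      | some q =>
        obtain ⟨h1, h2⟩ := (hmem_some p x).1 h
        obtain ⟨s, t, hc, hx⟩ := h'
        rw [hx] at h1 h2
        exact congrArg some (Subtype.ext (Prod.ext (single_ne h1).1 (single_ne h2).1))
  have hsome : ∀ p, SimplyConnectedSpace (A (some p)) := by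
    intro p
    obtain ⟨e⟩ := hom (some p)
    have hne : (Bcell k L r p.1.1 p.1.2).Nonempty := by
      obtain ⟨⟨i, j⟩, hi, hik, hj, hjk, hij, hrL⟩ := p
      have hi1 : 1 ≤ i := by simp only at hi; omega
      have hj1 : 1 ≤ j := by simp only at hj; omega
      have := hLpos i hi1 hik
      have := hLpos j hj1 hjk
      exact ⟨(Pi.single i (L i), Pi.single j (L j)), L i, L j,
        ⟨⟨hi1, hik, by linarith, le_rfl⟩, ⟨hj1, hjk, by linarith, le_rfl⟩, fun _ => hrL,
        fun h => absurd h hij⟩, rfl⟩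
    have : ContractibleSpace (Bset k L r (some p)) :=
      (Bcell_convex hr p.2.2.2.2.2.1).contractibleSpace hne
    have : ContractibleSpace (A (some p)) := e.contractibleSpace
    infer_instance
  obtain ⟨e0⟩ := main_hequiv k (by omega) r hr L hbig hsmall
  obtain ⟨e1⟩ := hom none
  let e : ContinuousMap.HomotopyEquiv (A none) {z : ℂ // z ≠ 0} := e1.toHomotopyEquiv.trans e0
  have hpcC : PathConnectedSpace {z : ℂ // z ≠ 0} := by
    have : IsPathConnected {z : ℂ | z ≠ 0} := by
      have := isPathConnected_compl_singleton_of_one_lt_rank (E := ℂ) (by simp) 0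
      exact this
    exact isPathConnected_iff_pathConnectedSpace.1 this
  have hnone : PathConnectedSpace (A none) := pathConnected_of_hequiv e
  have hpi : ∀ y : A none, Nonempty (FundamentalGroup (A none) y ≃* Multiplicative ℤ) := by
    intro y
    obtain ⟨a⟩ := pi1_of_hequiv e y
    obtain ⟨b⟩ := pi1_puncture (e y)
    exact ⟨a.trans b⟩
  have hpc : ∀ o, PathConnectedSpace (A o) := by
    intro o
    cases o with
    | none => exact hnone
    | some p => have := hsome p; infer_instance
  obtain ⟨hcard, hcomp⟩ := components_general A hopen hcov hdis hpc
  constructor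
  · rw [hcard]
    have hfin : Finite {p : ℕ × ℕ // 4 ≤ p.1 ∧ p.1 ≤ k ∧ 4 ≤ p.2 ∧ p.2 ≤ k ∧ p.1 ≠ p.2 ∧
        r ≤ L p.1 + L p.2} := by
      refine Set.Finite.to_subtype (s := {p : ℕ × ℕ | _}) ?_
      refine ((Set.finite_Iic k).prod (Set.finite_Iic k)).subset ?_
      rintro p ⟨_, h1, _, h2, _⟩
      exact ⟨h1, h2⟩
    rw [Finite.card_option]
    push_cast
    rw [count_pairs k hk r L hLpos hbig]
    ring
  · obtain ⟨x⟩ := hnone.nonempty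
    refine ⟨x.1, ?_, ?_, ?_⟩
    · rw [hcomp none x x.2]
      intro hsc
      obtain ⟨a⟩ := hpi x
      have : Subsingleton (FundamentalGroup (A none) x) := inferInstance
      have h2 : Subsingleton (Multiplicative ℤ) := a.symm.toEquiv.subsingleton
      exact not_subsingleton _ h2
    · intro y hy
      obtain ⟨o, ho⟩ := hcov y
      rw [hcomp o y ho] at hy ⊢
      rw [hcomp none x x.2]
      cases o with
      | none => rfl
      | some p => exact absurd (hsome p) hy
    · rw [hcomp none x x.2]
      exact hpi
end
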